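/- arXiv:1907.05573 — 3 statements merged into one kernel-verified Lean document; each statement's English description precedes it below -/
import Mathlib

section
/- Let S₁, …, S_m ∈ B(k,n) with m ≥ 1, and let G be the simple bipartite graph on the vertex set {1,…,n} ⊔ {1,…,m} in which an external vertex j ∈ {1,…,n} is adjacent to an internal vertex t ∈ {1,…,m} if and only if j ∈ S_t. If G contains a cycle (i.e., G is not acyclic), then the product ω_{S₁} · ω_{S₂} · ⋯ · ω_{S_m} equals 0 in A^k(n). -/
open FreeAlgebra

/-- Index set for the generators of the generalized Orlik–Solomon algebra:
`(k+1)`-element subsets of `{1,…,n}` (modelled as `Fin n`). -/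
abbrev OSGen (k n : ℕ) := {S : Finset (Fin n) // S.card = k + 1}

/-- The defining relations of the (even) generalized Orlik–Solomon algebra `A^k(n)`:
(i) anticommutativity `ω_S ω_T + ω_T ω_S = 0`;
(ii) `ω_S ω_T = 0` whenever `|S ∩ T| ≥ 2`;
(iii) for every injective `i : ℤ/(2k+1) → {1,…,n}` the cyclic sum
`∑_{m} ω_{i({m,…,m+k})} ω_{i({m+k,…,m+2k})} = 0`. -/
inductive OSRel (k n : ℕ) :
    FreeAlgebra ℚ (OSGen k n) → FreeAlgebra ℚ (OSGen k n) → Prop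
  | anticomm (S T : OSGen k n) :
      OSRel k n (ι ℚ S * ι ℚ T + ι ℚ T * ι ℚ S) 0
  | ortho (S T : OSGen k n) (h : 2 ≤ (S.1 ∩ T.1).card) :
      OSRel k n (ι ℚ S * ι ℚ T) 0
  | cyclic (i : ZMod (2 * k + 1) → Fin n) (hi : Function.Injective i)
      (A : ZMod (2 * k + 1) → OSGen k n)
      (hA : ∀ m : ZMod (2 * k + 1),
        (A m).1 = (Finset.range (k + 1)).image fun j : ℕ => i (m + (j : ZMod (2 * k + 1)))) :
      OSRel k n
        (∑ m : ZMod (2 * k + 1), ι ℚ (A m) * ι ℚ (A (m + (k : ZMod (2 * k + 1))))) 0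

/-- The (even) generalized Orlik–Solomon algebra `A^k(n)`. -/
abbrev OSAlg (k n : ℕ) := RingQuot (OSRel k n)

/-- The generator `ω_S` of `A^k(n)`. -/
noncomputable def omegaOS (k n : ℕ) (S : OSGen k n) : OSAlg k n :=
  RingQuot.mkAlgHom ℚ (OSRel k n) (ι ℚ S)

/-- The simple bipartite graph on `{1,…,n} ⊔ {1,…,m}` in which the external vertex `j`
is adjacent to the internal vertex `t` if and only if `j ∈ S t`. -/
def bipGraph (k n : ℕ) {m : ℕ} (S : Fin m → OSGen k n) :
    SimpleGraph (Fin n ⊕ Fin m) :=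
  SimpleGraph.fromRel fun x y =>
    ∃ (j : Fin n) (t : Fin m), x = Sum.inl j ∧ y = Sum.inr t ∧ j ∈ (S t).1

theorem omegaOS_mul_add_swap {k n : ℕ} (S T : OSGen k n) :
    omegaOS k n S * omegaOS k n T + omegaOS k n T * omegaOS k n S = 0 := by
  simpa [omegaOS] using RingQuot.mkAlgHom_rel ℚ (OSRel.anticomm S T)

theorem omegaOS_mul_eq_zero {k n : ℕ} {S T : OSGen k n} {p q : Fin n} (hpq : p ≠ q)
    (hpS : p ∈ S.1) (hqS : q ∈ S.1) (hpT : p ∈ T.1) (hqT : q ∈ T.1) :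
    omegaOS k n S * omegaOS k n T = 0 := by
  have h : 2 ≤ (S.1 ∩ T.1).card :=
    Finset.one_lt_card.2 ⟨p, by simp [*], q, by simp [*], hpq⟩
  simpa [omegaOS] using RingQuot.mkAlgHom_rel ℚ (OSRel.ortho S T h)

theorem omegaOS_cyclic_sum {k n : ℕ} (i : ZMod (2 * k + 1) → Fin n)
    (hi : Function.Injective i) (A : ZMod (2 * k + 1) → OSGen k n)
    (hA : ∀ m : ZMod (2 * k + 1),
      (A m).1 = (Finset.range (k + 1)).image fun j : ℕ => i (m + (j : ZMod (2 * k + 1)))) :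
    ∑ m : ZMod (2 * k + 1),
      omegaOS k n (A m) * omegaOS k n (A (m + (k : ZMod (2 * k + 1)))) = 0 := by
  simpa [omegaOS] using RingQuot.mkAlgHom_rel ℚ (OSRel.cyclic i hi A hA)

theorem mul_mul_mul_eq_zero_swap {R : Type*} [Ring R] {a b X Y : R} (h : a * b + b * a = 0)
    (h0 : X * (b * a) * Y = 0) : X * (a * b) * Y = 0 := by
  rw [eq_neg_of_add_eq_zero_left h, mul_neg, neg_mul, h0, neg_zero]

/-- Permuting anticommuting factors changes a product at most by a sign. -/
theorem List.Perm.prod_map_eq_or_eq_neg {R α : Type*} [Ring R] {f : α → R}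
    (hf : ∀ a b, f a * f b + f b * f a = 0) {L L' : List α} (h : L.Perm L') :
    (L.map f).prod = (L'.map f).prod ∨ (L.map f).prod = -(L'.map f).prod := by
  induction h with
  | nil => simp
  | cons x _ ih => rcases ih with h | h <;> simp [h]
  | swap x y l =>
    right
    simp only [List.map_cons, List.prod_cons, ← mul_assoc]
    rw [eq_neg_of_add_eq_zero_left (hf y x), neg_mul]
  | trans _ _ h₁ h₂ =>
    rcases h₁ with h₁ | h₁ <;> rcases h₂ with h₂ | h₂ <;> simp [h₁, h₂]

theorem List.Perm.prod_map_eq_zero {R α : Type*} [Ring R] {f : α → R}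
    (hf : ∀ a b, f a * f b + f b * f a = 0) {L L' : List α} (h : L.Perm L')
    (h0 : (L'.map f).prod = 0) : (L.map f).prod = 0 := by
  rcases h.prod_map_eq_or_eq_neg hf with h | h <;> simp [h, h0]

/-- Two blocks sharing only `x` can be laid out along a cycle of length `2k+1` so that prescribed
points `p`, `z` of the two blocks become the endpoints, hence cyclically adjacent. -/
theorem exists_cyclic_enumeration {k n : ℕ} {T₁ T₂ : OSGen k n} {p x z : Fin n}
    (hp : p ∈ T₁.1) (hx₁ : x ∈ T₁.1) (hx₂ : x ∈ T₂.1) (hz : z ∈ T₂.1)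
    (hpx : p ≠ x) (hzx : z ≠ x) (hT : ∀ y ∈ T₁.1, y ∈ T₂.1 → y = x) :
    ∃ i : ZMod (2 * k + 1) → Fin n, Function.Injective i ∧ i 0 = p ∧
      i ((2 * k : ℕ) : ZMod (2 * k + 1)) = z ∧
      (∀ j ≤ k, i (j : ZMod (2 * k + 1)) ∈ T₁.1) ∧
      ∀ j ≤ k, i ((k + j : ℕ) : ZMod (2 * k + 1)) ∈ T₂.1 := by
  classical
  obtain ⟨la, hla⟩ : ∃ la, la = p :: ((T₁.1.erase x).erase p).toList := ⟨_, rfl⟩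
  obtain ⟨lb, hlb⟩ : ∃ lb, lb = x :: (((T₂.1.erase x).erase z).toList ++ [z]) := ⟨_, rfl⟩
  have hk : 1 ≤ k := by
    have := Finset.one_lt_card.2 ⟨p, hp, x, hx₁, hpx⟩
    have := T₁.2
    omega
  have lena : la.length = k := by
    rw [hla, List.length_cons, Finset.length_toList,
      Finset.card_erase_of_mem (by simp [hp, hpx]), Finset.card_erase_of_mem hx₁, T₁.2]
    omega
  have lenb : lb.length = k + 1 := by
    rw [hlb, List.length_cons, List.length_append, Finset.length_toList,
      Finset.card_erase_of_mem (by simp [hz, hzx]), Finset.card_erase_of_mem hx₂, T₂.2]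
    simp only [List.length_singleton]
    omega
  have mema : ∀ y ∈ la, y ∈ T₁.1 ∧ y ≠ x := by
    intro y hy
    simp only [hla, List.mem_cons, Finset.mem_toList, Finset.mem_erase] at hy
    rcases hy with rfl | hy
    · exact ⟨hp, hpx⟩
    · exact ⟨hy.2.2, hy.2.1⟩
  have memb : ∀ y ∈ lb, y ∈ T₂.1 := by
    intro y hy
    simp only [hlb, List.mem_cons, List.mem_append, Finset.mem_toList, Finset.mem_erase,
      List.not_mem_nil, or_false] at hy
    rcases hy with rfl | hy | rfl
    exacts [hx₂, hy.2.2, hz]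
  have nda : la.Nodup := by
    rw [hla, List.nodup_cons]
    exact ⟨by simp, Finset.nodup_toList _⟩
  have ndb : lb.Nodup := by
    rw [hlb, List.nodup_cons]
    refine ⟨by simp [hzx.symm], ?_⟩
    rw [List.nodup_append]
    refine ⟨Finset.nodup_toList _, by simp, ?_⟩
    intro a ha b hb
    simp only [Finset.mem_toList, Finset.mem_erase, List.mem_singleton] at ha hb
    exact hb ▸ ha.1
  have nd : (la ++ lb).Nodup := by
    rw [List.nodup_append]
    refine ⟨nda, ndb, ?_⟩
    rintro a ha _ hb rfl
    exact (mema a ha).2 (hT a (mema a ha).1 (memb a hb))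
  have len : (la ++ lb).length = 2 * k + 1 := by
    rw [List.length_append, lena, lenb]; omega
  have hv : ∀ m : ZMod (2 * k + 1), m.val < (la ++ lb).length := fun m => by
    rw [len]; exact ZMod.val_lt m
  have hval : ∀ j < 2 * k + 1, ((j : ℕ) : ZMod (2 * k + 1)).val = j := fun j hj =>
    ZMod.val_natCast_of_lt hj
  refine ⟨fun m => (la ++ lb)[m.val]'(hv m), ?_, ?_, ?_, ?_, ?_⟩
  · intro a b hab
    exact ZMod.val_injective _ ((List.Nodup.getElem_inj_iff nd).1 hab)
  · simp [hla]
  · have h2 := hval (2 * k) (by omega)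
    simp only [h2]
    rw [List.getElem_append_right (by omega)]
    have : lb.getLast (by simp [hlb]) = z := by simp [hlb]
    rw [← this, List.getLast_eq_getElem]
    congr 1
    omega
  · intro j hj
    simp only [hval j (by omega)]
    rcases hj.lt_or_eq with h | rfl
    · rw [List.getElem_append_left (by omega)]
      exact (mema _ (List.getElem_mem _)).1
    · rw [List.getElem_append_right (by omega)]
      simpa [lena, hlb] using hx₁
  · intro j hj
    simp only [hval (k + j) (by omega)]
    rw [List.getElem_append_right (by omega)]
    exact memb _ (List.getElem_mem _)

/-- The block of `k+1` cyclically consecutive values of `i` starting at position `m`. -/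
def cyclicArc {k n : ℕ} (i : ZMod (2 * k + 1) → Fin n) (hi : Function.Injective i)
    (m : ZMod (2 * k + 1)) : OSGen k n :=
  ⟨(Finset.range (k + 1)).image fun j : ℕ => i (m + (j : ZMod (2 * k + 1))), by
    rw [Finset.card_image_of_injOn, Finset.card_range]
    intro a ha b hb hab
    simp only [Finset.coe_range, Set.mem_Iio] at ha hb
    have := congrArg ZMod.val (add_left_cancel (hi hab))
    rwa [ZMod.val_natCast_of_lt (by omega), ZMod.val_natCast_of_lt (by omega)] at this⟩

theorem mem_cyclicArc {k n : ℕ} {i : ZMod (2 * k + 1) → Fin n} {hi : Function.Injective i}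
    {m : ZMod (2 * k + 1)} {j : ℕ} (hj : j ≤ k) {y : Fin n}
    (hy : i (m + (j : ZMod (2 * k + 1))) = y) : y ∈ (cyclicArc i hi m).1 :=
  Finset.mem_image.2 ⟨j, Finset.mem_range.2 (by omega), hy⟩

/-- Apart from `m = 0`, one of the two arcs in each summand of the cyclic relation contains both
the first and the last position. -/
theorem endpoints_mem_cyclicArc {k n : ℕ} (i : ZMod (2 * k + 1) → Fin n)
    (hi : Function.Injective i) {m : ZMod (2 * k + 1)} (hm : m ≠ 0) :
    (i 0 ∈ (cyclicArc i hi m).1 ∧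
        i ((2 * k : ℕ) : ZMod (2 * k + 1)) ∈ (cyclicArc i hi m).1) ∨
      (i 0 ∈ (cyclicArc i hi (m + (k : ZMod (2 * k + 1)))).1 ∧
        i ((2 * k : ℕ) : ZMod (2 * k + 1)) ∈
          (cyclicArc i hi (m + (k : ZMod (2 * k + 1)))).1) := by
  obtain ⟨v, hv, rfl⟩ : ∃ v : ℕ, v < 2 * k + 1 ∧ (v : ZMod (2 * k + 1)) = m :=
    ⟨m.val, ZMod.val_lt m, ZMod.natCast_zmod_val m⟩
  have hv0 : v ≠ 0 := by rintro rfl; simp at hm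
  have h0 : (0 : ZMod (2 * k + 1)) = ((2 * k + 1 : ℕ) : ZMod (2 * k + 1)) :=
    (ZMod.natCast_self _).symm
  rcases le_or_gt v k with h | h
  · right
    refine ⟨mem_cyclicArc (j := k - v + 1) (by omega) (congrArg i ?_),
      mem_cyclicArc (j := k - v) (by omega) (congrArg i ?_)⟩
    · rw [h0, ← Nat.cast_add, ← Nat.cast_add]
      congr 1
      omega
    · rw [← Nat.cast_add, ← Nat.cast_add]
      congr 1
      omega
  · left
    refine ⟨mem_cyclicArc (j := 2 * k + 1 - v) (by omega) (congrArg i ?_),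
      mem_cyclicArc (j := 2 * k - v) (by omega) (congrArg i ?_)⟩
    · rw [h0, ← Nat.cast_add]
      congr 1
      omega
    · rw [← Nat.cast_add]
      congr 1
      omega

/-- The product of two generators joined by `x` lies in the span of products of two generators
the first of which contains both `p` and `z`. -/
theorem mul_omegaOS_mul_mul_eq_zero {k n : ℕ} {T₁ T₂ : OSGen k n} {p x z : Fin n}
    (hp : p ∈ T₁.1) (hx₁ : x ∈ T₁.1) (hx₂ : x ∈ T₂.1) (hz : z ∈ T₂.1)
    (hpx : p ≠ x) (hzx : z ≠ x) {X Y : OSAlg k n}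
    (h : ∀ T V : OSGen k n, p ∈ T.1 → z ∈ T.1 →
      X * (omegaOS k n T * omegaOS k n V) * Y = 0) :
    X * (omegaOS k n T₁ * omegaOS k n T₂) * Y = 0 := by
  by_cases hT : ∀ y ∈ T₁.1, y ∈ T₂.1 → y = x
  · obtain ⟨i, hi, rfl, rfl, h₁, h₂⟩ := exists_cyclic_enumeration hp hx₁ hx₂ hz hpx hzx hT
    have e₁ : cyclicArc i hi 0 = T₁ := by
      refine Subtype.ext (Finset.eq_of_subset_of_card_le ?_ ?_)
      · intro y hy
        obtain ⟨j, hj, rfl⟩ := Finset.mem_image.1 hy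
        simpa using h₁ j (by simpa [Nat.lt_succ_iff] using hj)
      · rw [(cyclicArc i hi 0).2, T₁.2]
    have e₂ : cyclicArc i hi (0 + (k : ZMod (2 * k + 1))) = T₂ := by
      refine Subtype.ext (Finset.eq_of_subset_of_card_le ?_ ?_)
      · intro y hy
        obtain ⟨j, hj, rfl⟩ := Finset.mem_image.1 hy
        simpa using h₂ j (by simpa [Nat.lt_succ_iff] using hj)
      · rw [(cyclicArc i hi _).2, T₂.2]
    have hsum := congrArg (fun a => X * a * Y)
      (omegaOS_cyclic_sum i hi (cyclicArc i hi) fun _ => rfl)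
    simp only [Finset.mul_sum, Finset.sum_mul, mul_zero, zero_mul] at hsum
    rw [Finset.sum_eq_single 0, e₁, e₂] at hsum
    · exact hsum
    · intro m _ hm
      rcases endpoints_mem_cyclicArc i hi hm with ⟨ha, hb⟩ | ⟨ha, hb⟩
      · exact h _ _ ha hb
      · exact mul_mul_mul_eq_zero_swap (omegaOS_mul_add_swap _ _) (h _ _ ha hb)
    · simp
  · push Not at hT
    obtain ⟨y, hy₁, hy₂, hyx⟩ := hT
    rw [omegaOS_mul_eq_zero hyx hy₁ hx₁ hy₂ hx₂, mul_zero, zero_mul]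

/-- `OSChain p q x L` says that `x` can be joined to `q` through the successive blocks of `L`,
moving in each block to a point which is new and different from `p`. -/
def OSChain {k n : ℕ} (p q : Fin n) : Fin n → List (OSGen k n) → Prop
  | x, [] => x = q
  | x, T :: L => x ∈ T.1 ∧ ∃ y ∈ T.1, y ≠ x ∧ y ≠ p ∧ OSChain p q y L

theorem omegaOS_mul_prod_eq_zero_of_chain {k n : ℕ} {p q : Fin n} {U : OSGen k n}
    (hpU : p ∈ U.1) (hqU : q ∈ U.1) (L : List (OSGen k n)) (T : OSGen k n)
    (hL : OSChain p q p (T :: L)) :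
    omegaOS k n U * (omegaOS k n T * (L.map (omegaOS k n)).prod) = 0 := by
  induction L generalizing T with
  | nil =>
    obtain ⟨hpT, y, hyT, hyp, -, rfl⟩ := hL
    simp [omegaOS_mul_eq_zero hyp.symm hpU hqU hpT hyT]
  | cons T₂ L ih =>
    obtain ⟨hpT, y, hyT, hyp, -, hyT₂, z, hzT₂, hzy, hzp, hz⟩ := hL
    have key := mul_omegaOS_mul_mul_eq_zero (X := omegaOS k n U)
      (Y := (L.map (omegaOS k n)).prod) hpT hyT hyT₂ hzT₂ hyp.symm hzy fun T' V hp' hz' => by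
        have h0 := ih T' ⟨hp', z, hz', hzp, hzp, hz⟩
        refine mul_mul_mul_eq_zero_swap (omegaOS_mul_add_swap T' V) ?_
        have h1 := mul_mul_mul_eq_zero_swap (X := 1)
          (Y := omegaOS k n T' * (L.map (omegaOS k n)).prod) (omegaOS_mul_add_swap U V)
          (by rw [one_mul, mul_assoc, h0, mul_zero])
        simpa only [one_mul, mul_assoc] using h1
    simpa [mul_assoc] using key

theorem bipGraph_adj_inl {k n m : ℕ} {S : Fin m → OSGen k n} {j : Fin n} {v : Fin n ⊕ Fin m}
    (h : (bipGraph k n S).Adj (Sum.inl j) v) : ∃ t, v = Sum.inr t ∧ j ∈ (S t).1 := by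
  simp only [bipGraph, SimpleGraph.fromRel_adj] at h
  obtain ⟨-, ⟨a, t, h₁, h₂, h₃⟩ | ⟨a, t, h₁, h₂, h₃⟩⟩ := h
  · cases h₁
    exact ⟨t, h₂, h₃⟩
  · cases h₂

theorem bipGraph_adj_inr {k n m : ℕ} {S : Fin m → OSGen k n} {t : Fin m} {v : Fin n ⊕ Fin m}
    (h : (bipGraph k n S).Adj (Sum.inr t) v) : ∃ j, v = Sum.inl j ∧ j ∈ (S t).1 := by
  simp only [bipGraph, SimpleGraph.fromRel_adj] at h
  obtain ⟨-, ⟨a, t, h₁, h₂, h₃⟩ | ⟨a, t, h₁, h₂, h₃⟩⟩ := h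
  · cases h₁
  · cases h₂
    exact ⟨a, h₁, h₃⟩

/-- A path from an external to an internal vertex gives a chain of blocks. -/
theorem exists_chain_of_isPath {k n m : ℕ} {S : Fin m → OSGen k n}
    {G : SimpleGraph (Fin n ⊕ Fin m)} (hG : G ≤ bipGraph k n S) (p : Fin n) (t : Fin m) (N : ℕ) :
    ∀ (x : Fin n) (w : G.Walk (Sum.inl x) (Sum.inr t)), w.length ≤ N → w.IsPath →
      Sum.inl p ∉ w.support.tail →
      ∃ (q : Fin n) (l : List (Fin m)), q ∈ (S t).1 ∧ OSChain p q x (l.map S) ∧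
        (t :: l).Nodup ∧ (∀ s ∈ l, Sum.inr s ∈ w.support) ∧
        (l = [] → G.Adj (Sum.inl x) (Sum.inr t)) := by
  induction N using Nat.strong_induction_on with
  | _ N ih =>
    intro x w hN hw hp
    cases w with
    | cons h w =>
      obtain ⟨s, rfl, hs⟩ := bipGraph_adj_inl (hG h)
      cases w with
      | nil => exact ⟨x, [], hs, rfl, by simp, by simp, fun _ => h⟩
      | cons h' w =>
        obtain ⟨y, rfl, hy⟩ := bipGraph_adj_inr (hG h')
        simp only [SimpleGraph.Walk.length_cons] at hN
        simp only [SimpleGraph.Walk.cons_isPath_iff, SimpleGraph.Walk.support_cons,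
          List.mem_cons, not_or] at hw
        simp only [SimpleGraph.Walk.support_cons, List.tail_cons, List.mem_cons, not_or] at hp
        obtain ⟨⟨hw, hsw⟩, -, hxw⟩ := hw
        obtain ⟨q, l, hq, hl, hnd, hmem, -⟩ := ih (N - 2) (by omega) y w (by omega) hw
          fun h => hp.2 (List.mem_of_mem_tail h)
        rw [List.nodup_cons] at hnd
        refine ⟨q, s :: l, hq, ⟨hs, y, hy, ?_, ?_, hl⟩, ?_, ?_, by simp⟩
        · rintro rfl
          exact hxw w.start_mem_support
        · rintro rfl
          exact hp.2 w.start_mem_support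
        · simp only [List.nodup_cons, List.mem_cons, not_or]
          refine ⟨⟨?_, hnd.1⟩, fun h => hsw (hmem _ h), hnd.2⟩
          rintro rfl
          exact hsw w.end_mem_support
        · intro r hr
          rcases List.mem_cons.1 hr with rfl | hr
          · simp
          · simp [hmem r hr]

/-- A non-acyclic incidence graph has an incidence which is not a bridge. -/
theorem exists_reachable_deleteEdges_of_not_isAcyclic {k n m : ℕ} {S : Fin m → OSGen k n}
    (h : ¬ (bipGraph k n S).IsAcyclic) :
    ∃ (p : Fin n) (t : Fin m), p ∈ (S t).1 ∧
      ((bipGraph k n S).deleteEdges {s(Sum.inl p, Sum.inr t)}).Reachable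
        (Sum.inl p) (Sum.inr t) := by
  rw [SimpleGraph.isAcyclic_iff_forall_isBridge] at h
  push Not at h
  obtain ⟨e, hvw, hb⟩ := h
  induction e with | _ v w
  rw [SimpleGraph.mem_edgeSet] at hvw
  simp only [SimpleGraph.isBridge_iff, not_not] at hb
  rcases v with p | t
  · obtain ⟨t, rfl, hp⟩ := bipGraph_adj_inl hvw
    exact ⟨p, t, hp, by simpa using hb⟩
  · obtain ⟨p, rfl, hp⟩ := bipGraph_adj_inr hvw
    exact ⟨p, t, hp, by simpa [Sym2.eq_swap] using hb.symm⟩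

/-- If the bipartite graph associated to `S₁, …, S_m ∈ B(k,n)` contains a
cycle (i.e. is not acyclic), then the product `ω_{S₁} ⋯ ω_{S_m}` vanishes in `A^k(n)`. -/
theorem os_cyclic_monomial_vanishes (k n : ℕ) (hk : 1 ≤ k)
    (m : ℕ) (hm : 1 ≤ m) (S : Fin m → OSGen k n)
    (hcyc : ¬ (bipGraph k n S).IsAcyclic) :
    (List.ofFn fun t => omegaOS k n (S t)).prod = 0 := by
  classical
  obtain ⟨p, t, hp, hr⟩ := exists_reachable_deleteEdges_of_not_isAcyclic hcyc
  obtain ⟨w, hw⟩ := hr.exists_isPath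
  have hpw : Sum.inl p ∉ w.support.tail := by
    have := hw.support_nodup
    rw [← SimpleGraph.Walk.cons_tail_support, List.nodup_cons] at this
    exact this.1
  obtain ⟨q, l, hq, hl, hnd, -, hne⟩ := exists_chain_of_isPath
    (SimpleGraph.deleteEdges_le _) p t w.length p w le_rfl hw hpw
  obtain ⟨l', hl', hsub⟩ := hnd.subperm fun a _ => List.mem_finRange a
  obtain ⟨r, hr⟩ := hsub.exists_perm_append
  have hperm := hr.trans (hl'.append_right r)
  have hzero : (((t :: l ++ r).map S).map (omegaOS k n)).prod = 0 := by
    cases l with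
    | nil => simp [SimpleGraph.deleteEdges_adj] at hne
    | cons s l =>
      have := omegaOS_mul_prod_eq_zero_of_chain hp hq (l.map S) (S s) hl
      rw [List.map_append, List.map_append, List.prod_append]
      simp only [List.map_cons, List.prod_cons]
      rw [this, zero_mul]
  have hprod : (List.ofFn fun t => omegaOS k n (S t)) =
      ((List.finRange m).map S).map (omegaOS k n) := by
    rw [List.map_map, List.ofFn_eq_map]
    rfl
  rw [hprod]
  exact (hperm.map S).prod_map_eq_zero omegaOS_mul_add_swap hzero
end

section
/- Every element of A^k(n) is a ℚ-linear combination of the identity 1 and of products ω_{S₁} · ⋯ · ω_{S_m} (with S₁, …, S_m ∈ B(k,n), m ≥ 1) whose associated simple bipartite graph on {1,…,n} ⊔ {1,…,m} — where external vertex j is adjacent to internal vertex t if and only if j ∈ S_t — is acyclic, i.e., a forest. -/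
open FreeAlgebra

section Relations

variable {k n : ℕ}

theorem omegaOS_mul_comm (S T : OSGen k n) :
    omegaOS k n S * omegaOS k n T = (-1 : ℚ) • (omegaOS k n T * omegaOS k n S) := by
  have h := RingQuot.mkAlgHom_rel ℚ (OSRel.anticomm S T)
  simp only [map_add, map_mul, map_zero] at h
  exact (eq_neg_of_add_eq_zero_left h).trans (neg_one_smul ℚ _).symm

theorem omegaOS_mul_eq_zero_s5 {S T : OSGen k n} {a b : Fin n} (hab : a ≠ b)
    (haS : a ∈ S.1) (hbS : b ∈ S.1) (haT : a ∈ T.1) (hbT : b ∈ T.1) :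
    omegaOS k n S * omegaOS k n T = 0 := by
  have hcard : 2 ≤ (S.1 ∩ T.1).card := by
    rw [← Finset.card_pair hab]
    apply Finset.card_le_card
    intro x hx
    simp only [Finset.mem_insert, Finset.mem_singleton] at hx
    rcases hx with rfl | rfl <;> simp [*]
  have h := RingQuot.mkAlgHom_rel ℚ (OSRel.ortho S T hcard)
  rwa [map_mul, map_zero] at h

theorem sum_omegaOS_eq_zero (i : ZMod (2 * k + 1) → Fin n) (hi : Function.Injective i)
    (A : ZMod (2 * k + 1) → OSGen k n)
    (hA : ∀ m : ZMod (2 * k + 1),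
      (A m).1 = (Finset.range (k + 1)).image fun j : ℕ => i (m + (j : ZMod (2 * k + 1)))) :
    ∑ m : ZMod (2 * k + 1), omegaOS k n (A m) * omegaOS k n (A (m + (k : ZMod (2 * k + 1)))) =
      0 := by
  have h := RingQuot.mkAlgHom_rel ℚ (OSRel.cyclic i hi A hA)
  simp only [map_sum, map_mul, map_zero] at h
  exact h

/-- Up to a scalar, the product of generators does not depend on their order. -/
theorem exists_prod_omegaOS_eq_smul_of_perm {L L' : List (OSGen k n)} (h : L.Perm L') :
    ∃ q : ℚ, (L.map (omegaOS k n)).prod = q • (L'.map (omegaOS k n)).prod := by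
  induction h with
  | nil => exact ⟨1, (one_smul _ _).symm⟩
  | cons S _ ih =>
    obtain ⟨q, hq⟩ := ih
    exact ⟨q, by simp only [List.map_cons, List.prod_cons, hq, mul_smul_comm]⟩
  | swap S T L =>
    refine ⟨-1, ?_⟩
    simp only [List.map_cons, List.prod_cons, ← mul_assoc]
    rw [omegaOS_mul_comm, smul_mul_assoc]
  | trans _ _ ih₁ ih₂ =>
    obtain ⟨q, hq⟩ := ih₁
    obtain ⟨r, hr⟩ := ih₂
    exact ⟨q * r, by rw [hq, hr, mul_smul]⟩

end Relations

section CyclicOrder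

variable {k n : ℕ}

theorem injOn_natCast_zmod : Set.InjOn (fun j : ℕ => (j : ZMod (2 * k + 1)))
    (Finset.range (2 * k + 1)) := by
  intro x hx y hy hxy
  simp only [Finset.coe_range, Set.mem_Iio] at hx hy
  have := congrArg ZMod.val hxy
  simpa [ZMod.val_natCast_of_lt hx, ZMod.val_natCast_of_lt hy] using this

/-- Two generators meeting in one point can be placed consecutively on the cycle `ℤ/(2k+1)`,
with prescribed points at the two ends. -/
theorem exists_cyclic_enumeration_s5 {S T : OSGen k n} {a b c : Fin n}
    (hST : S.1 ∩ T.1 = {b}) (ha : a ∈ S.1) (hab : a ≠ b) (hc : c ∈ T.1) (hcb : c ≠ b) :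
    ∃ i : ZMod (2 * k + 1) → Fin n, Function.Injective i ∧ i 0 = a ∧ i (2 * k) = c ∧
      (∀ j ∈ Finset.range (k + 1), i j ∈ S.1) ∧
      (∀ j ∈ Finset.range (k + 1), i (k + j) ∈ T.1) := by
  have hb : b ∈ S.1 ∩ T.1 := by simp [hST]
  have hmeet : ∀ x, x ∈ S.1 → x ∈ T.1 → x = b := fun x h₁ h₂ => by
    simpa [hST] using Finset.mem_inter.2 ⟨h₁, h₂⟩
  obtain ⟨hbS, hbT⟩ := Finset.mem_inter.1 hb
  set U := ((S.1.erase a).erase b).toList with hU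
  set V := ((T.1.erase b).erase c).toList with hV
  have hUl : U.length + 2 = k + 1 := by
    have h₁ := Finset.card_erase_add_one (Finset.mem_erase.2 ⟨hab.symm, hbS⟩)
    have h₂ := Finset.card_erase_add_one ha
    have := S.2
    simp only [hU, Finset.length_toList]
    omega
  have hVl : V.length + 2 = k + 1 := by
    have h₁ := Finset.card_erase_add_one (Finset.mem_erase.2 ⟨hcb, hc⟩)
    have h₂ := Finset.card_erase_add_one hbT
    have := T.2
    simp only [hV, Finset.length_toList]
    omega
  have hUm : ∀ x, x ∈ U ↔ x ≠ b ∧ x ≠ a ∧ x ∈ S.1 := by simp [hU]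
  have hVm : ∀ x, x ∈ V ↔ x ≠ c ∧ x ≠ b ∧ x ∈ T.1 := by simp [hV]
  have hUn : U.Nodup := Finset.nodup_toList _
  have hVn : V.Nodup := Finset.nodup_toList _
  set l : List (Fin n) := ((a :: U) ++ [b]) ++ (V ++ [c]) with hl
  have hll : l.length = 2 * k + 1 := by simp [hl]; omega
  have hln : l.Nodup := by
    simp only [hl, List.nodup_append, List.nodup_cons, List.mem_append, List.mem_cons,
      List.not_mem_nil, or_false, hUm, hVm]
    grind
  have hlt : ∀ m : ZMod (2 * k + 1), m.val < l.length := fun m => by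
    rw [hll]
    exact ZMod.val_lt m
  have hval : ∀ j : ℕ, (h : j < l.length) →
      l[(j : ZMod (2 * k + 1)).val]'(hlt _) = l[j] := fun j h => by
    congr 1
    exact ZMod.val_natCast_of_lt (by omega)
  refine ⟨fun m => l[m.val]'(hlt m), ?_, ?_, ?_, ?_, ?_⟩
  · intro x y hxy
    exact ZMod.val_injective _ ((hln.getElem_inj_iff).1 hxy)
  · simp [hl]
  · have h := hval (2 * k) (by omega)
    push_cast at h
    refine h.trans ?_
    simp only [hl]
    grind
  · intro j hj
    rw [Finset.mem_range] at hj
    beta_reduce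
    rw [hval j (by omega)]
    have : l[j]'(by omega) ∈ (a :: U) ++ [b] := by
      simp only [hl]
      rw [List.getElem_append_left (by simp; omega)]
      exact List.getElem_mem _
    simp only [List.mem_append, List.mem_cons, List.not_mem_nil, or_false, hUm] at this
    grind
  · intro j hj
    rw [Finset.mem_range] at hj
    have h := hval (k + j) (by omega)
    push_cast at h
    beta_reduce
    rw [h]
    rcases Nat.eq_zero_or_pos j with rfl | hj0
    · have : l[k + 0]'(by omega) = b := by
        simp only [hl]
        grind
      rwa [this]
    · have : l[k + j]'(by omega) ∈ V ++ [c] := by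
        simp only [hl]
        rw [List.getElem_append_right (by simp; omega)]
        exact List.getElem_mem _
      simp only [List.mem_append, List.mem_cons, List.not_mem_nil, or_false, hVm] at this
      grind

/-- If `S` and `T` meet in one point, then `ω_S ω_T` is a combination of products in which one
factor contains both prescribed points `a ∈ S` and `c ∈ T`. -/
theorem omegaOS_mul_mul_eq_zero {S T : OSGen k n} {a b c : Fin n}
    (hST : S.1 ∩ T.1 = {b}) (ha : a ∈ S.1) (hab : a ≠ b) (hc : c ∈ T.1) (hcb : c ≠ b)
    {P : OSAlg k n} (hP : ∀ R : OSGen k n, a ∈ R.1 → c ∈ R.1 → omegaOS k n R * P = 0) :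
    omegaOS k n S * omegaOS k n T * P = 0 := by
  obtain ⟨i, hi, hia, hic, hiS, hiT⟩ := exists_cyclic_enumeration_s5 hST ha hab hc hcb
  have hcard : ∀ m : ZMod (2 * k + 1), ((Finset.range (k + 1)).image
      fun j : ℕ => i (m + (j : ZMod (2 * k + 1)))).card = k + 1 := fun m => by
    rw [Finset.card_image_of_injOn, Finset.card_range]
    intro x hx y hy hxy
    simp only [Finset.coe_range, Set.mem_Iio] at hx hy
    refine injOn_natCast_zmod (k := k) ?_ ?_ (add_left_cancel (hi hxy)) <;>
      simp only [Finset.coe_range, Set.mem_Iio] <;> omega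
  let A : ZMod (2 * k + 1) → OSGen k n := fun m => ⟨_, hcard m⟩
  have hA0 : A 0 = S := by
    refine Subtype.ext (Finset.eq_of_subset_of_card_le ?_ (by rw [(A 0).2, S.2]))
    intro x hx
    obtain ⟨j, hj, rfl⟩ := Finset.mem_image.1 hx
    simpa using hiS j hj
  have hAk : A (0 + k) = T := by
    refine Subtype.ext (Finset.eq_of_subset_of_card_le ?_ (by rw [(A (0 + k)).2, T.2]))
    intro x hx
    obtain ⟨j, hj, rfl⟩ := Finset.mem_image.1 hx
    simpa using hiT j hj
  have hmem : ∀ (m : ZMod (2 * k + 1)) (j : ℕ), j ≤ k → i (m + j) ∈ (A m).1 := fun m j hj =>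
    Finset.mem_image.2 ⟨j, Finset.mem_range.2 (by omega), rfl⟩
  have hmod : ((2 * k + 1 : ℕ) : ZMod (2 * k + 1)) = 0 := ZMod.natCast_self _
  have hzero : ∀ m : ZMod (2 * k + 1), m ≠ 0 →
      omegaOS k n (A m) * omegaOS k n (A (m + k)) * P = 0 := by
    intro m hm
    have hv : m.val ≠ 0 := by simpa [ZMod.val_eq_zero] using hm
    have hlt := ZMod.val_lt m
    have hmv : m = (m.val : ZMod (2 * k + 1)) := by simp
    rcases le_or_gt m.val k with hle | hgt
    · have h₁ : a ∈ (A (m + k)).1 := by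
        convert hmem (m + k) (k + 1 - m.val) (by omega) using 1
        rw [← hia]
        congr 1
        rw [← hmod]
        nth_rw 1 [hmv]
        norm_cast
        congr 1
        omega
      have h₂ : c ∈ (A (m + k)).1 := by
        convert hmem (m + k) (k - m.val) (by omega) using 1
        rw [← hic]
        congr 1
        nth_rw 1 [hmv]
        norm_cast
        congr 1
        omega
      rw [mul_assoc, hP _ h₁ h₂, mul_zero]
    · have h₁ : a ∈ (A m).1 := by
        convert hmem m (2 * k + 1 - m.val) (by omega) using 1
        rw [← hia]
        congr 1
        rw [← hmod]
        nth_rw 1 [hmv]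
        norm_cast
        congr 1
        omega
      have h₂ : c ∈ (A m).1 := by
        convert hmem m (2 * k - m.val) (by omega) using 1
        rw [← hic]
        congr 1
        nth_rw 1 [hmv]
        norm_cast
        congr 1
        omega
      rw [omegaOS_mul_comm, smul_mul_assoc, mul_assoc, hP _ h₁ h₂, mul_zero, smul_zero]
  have hsum := congrArg (· * P) (sum_omegaOS_eq_zero i hi A fun _ => rfl)
  simp only [Finset.sum_mul, zero_mul] at hsum
  rw [Finset.sum_eq_single 0 (fun m _ hm => hzero m hm) (by simp), hA0, hAk] at hsum
  exact hsum

end CyclicOrder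

section Cycles

variable {k n : ℕ}

/-- `OSChain L a b` means that one can go from `a` to `b` by moving successively inside
the sets of the list `L`. -/
inductive OSChain_s5 : List (OSGen k n) → Fin n → Fin n → Prop
  | nil (a : Fin n) : OSChain_s5 [] a a
  | cons {T : OSGen k n} {L : List (OSGen k n)} {a b c : Fin n} (ha : a ∈ T.1) (hc : c ∈ T.1)
      (h : OSChain_s5 L c b) : OSChain_s5 (T :: L) a b

/-- A product of generators along a closed chain vanishes. -/
theorem omegaOS_mul_prod_eq_zero_of_chain_s5 {L : List (OSGen k n)} {a b : Fin n}
    (h : OSChain_s5 L b a) (hab : a ≠ b) (S : OSGen k n) (ha : a ∈ S.1) (hb : b ∈ S.1) :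
    omegaOS k n S * (L.map (omegaOS k n)).prod = 0 := by
  induction h generalizing S with
  | nil => exact absurd rfl hab
  | @cons T L b a c hbT hc h ih =>
    rw [List.map_cons, List.prod_cons, ← mul_assoc]
    by_cases hac : a = c
    · subst hac
      rw [omegaOS_mul_eq_zero_s5 hab ha hb hc hbT, zero_mul]
    by_cases hcb : c = b
    · subst hcb
      rw [omegaOS_mul_comm, smul_mul_assoc, mul_assoc, ih hab S ha hb, mul_zero, smul_zero]
    by_cases hST : S.1 ∩ T.1 = {b}
    · exact omegaOS_mul_mul_eq_zero hST ha hab hc hcb fun R haR hcR => ih hac R haR hcR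
    · obtain ⟨x, hx, hxb⟩ : ∃ x ∈ S.1 ∩ T.1, x ≠ b := by
        by_contra! hx
        exact hST (Finset.eq_singleton_iff_unique_mem.2 ⟨Finset.mem_inter.2 ⟨hb, hbT⟩, hx⟩)
      obtain ⟨hxS, hxT⟩ := Finset.mem_inter.1 hx
      rw [omegaOS_mul_eq_zero_s5 hxb hxS hb hxT hbT, zero_mul]

variable {m : ℕ} (S : Fin m → OSGen k n)

theorem bipGraph_adj_inl_inr (j : Fin n) (t : Fin m) :
    (bipGraph k n S).Adj (Sum.inl j) (Sum.inr t) ↔ j ∈ (S t).1 := by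
  simp [bipGraph]

theorem bipGraph_not_adj_inl_inl (i j : Fin n) :
    ¬ (bipGraph k n S).Adj (Sum.inl i) (Sum.inl j) := by
  simp [bipGraph]

theorem bipGraph_not_adj_inr_inr (s t : Fin m) :
    ¬ (bipGraph k n S).Adj (Sum.inr s) (Sum.inr t) := by
  simp [bipGraph]

/-- The internal vertices along a path form a chain. -/
theorem exists_chain_of_isPath_s5 {x y : Fin n ⊕ Fin m} (p : (bipGraph k n S).Walk x y)
    (hp : p.IsPath) {b : Fin n} (hy : y = Sum.inl b) :
    ∃ l : List (Fin m), l.Nodup ∧ (∀ s ∈ l, Sum.inr s ∈ p.support) ∧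
      ∀ a, (x = Sum.inl a ∨ ∃ t, x = Sum.inr t ∧ a ∈ (S t).1) → OSChain_s5 (l.map S) a b := by
  induction p with
  | nil =>
    subst hy
    refine ⟨[], by simp, by simp, ?_⟩
    rintro a (h | ⟨t, h, -⟩)
    · cases h
      exact .nil _
    · cases h
  | @cons u v w huv p ih =>
    rw [SimpleGraph.Walk.cons_isPath_iff] at hp
    obtain ⟨l, hl, hls, hch⟩ := ih hp.1 hy
    rcases u with c | t <;> rcases v with d | s
    · exact absurd huv (bipGraph_not_adj_inl_inl S c d)
    · refine ⟨l, hl, fun r hr => by simp [hls r hr], ?_⟩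
      rintro a (h | ⟨t, h, -⟩)
      · cases h
        exact hch c (.inr ⟨s, rfl, (bipGraph_adj_inl_inr S _ _).1 huv⟩)
      · cases h
    · refine ⟨t :: l, List.nodup_cons.2 ⟨fun h => hp.2 (hls t h), hl⟩, ?_, ?_⟩
      · intro r hr
        rcases List.mem_cons.1 hr with rfl | hr
        · simp
        · simp [hls r hr]
      · rintro a (h | ⟨t', h, ha⟩)
        · cases h
        · cases h
          exact .cons ha ((bipGraph_adj_inl_inr S _ _).1 huv.symm) (hch d (.inl rfl))
    · exact absurd huv (bipGraph_not_adj_inr_inr S t s)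

theorem exists_chain_of_not_isAcyclic (h : ¬ (bipGraph k n S).IsAcyclic) :
    ∃ (t : Fin m) (l : List (Fin m)) (a b : Fin n), (t :: l).Nodup ∧ a ≠ b ∧
      a ∈ (S t).1 ∧ b ∈ (S t).1 ∧ OSChain_s5 (l.map S) b a := by
  obtain ⟨a, t, hat, hr⟩ : ∃ (a : Fin n) (t : Fin m), a ∈ (S t).1 ∧
      ((bipGraph k n S).deleteEdges {s(Sum.inl a, Sum.inr t)}).Reachable
        (Sum.inr t) (Sum.inl a) := by
    simp only [SimpleGraph.isAcyclic_iff_forall_adj_isBridge, not_forall] at h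
    obtain ⟨x, y, hxy, hb⟩ := h
    simp only [SimpleGraph.isBridge_iff, not_not] at hb
    rcases x with c | t <;> rcases y with d | s
    · exact absurd hxy (bipGraph_not_adj_inl_inl S c d)
    · exact ⟨c, s, (bipGraph_adj_inl_inr S _ _).1 hxy, hb.symm⟩
    · exact ⟨d, t, (bipGraph_adj_inl_inr S _ _).1 hxy.symm, Sym2.eq_swap ▸ hb⟩
    · exact absurd hxy (bipGraph_not_adj_inr_inr S t s)
  obtain ⟨p, hp⟩ := hr.exists_isPath
  cases p with
  | @cons _ v _ htv p =>
    rw [SimpleGraph.Walk.cons_isPath_iff] at hp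
    rw [SimpleGraph.deleteEdges_adj] at htv
    rcases v with b | s
    · have hab : a ≠ b := by
        rintro rfl
        exact htv.2 (by simp [Sym2.eq_swap])
      obtain ⟨l, hl, hls, hch⟩ := exists_chain_of_isPath_s5 S
        (p.mapLe (SimpleGraph.deleteEdges_le _)) (hp.1.mapLe _) rfl
      refine ⟨t, l, a, b, List.nodup_cons.2 ⟨fun ht => hp.2 ?_, hl⟩, hab, hat,
        (bipGraph_adj_inl_inr S _ _).1 htv.1.symm, hch b (.inl rfl)⟩
      simpa using hls t ht
    · exact absurd htv.1 (bipGraph_not_adj_inr_inr S t s)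

/-- A product of generators whose bipartite graph contains a cycle vanishes. -/
theorem prod_omegaOS_eq_zero_of_not_isAcyclic (h : ¬ (bipGraph k n S).IsAcyclic) :
    (List.ofFn fun t => omegaOS k n (S t)).prod = 0 := by
  obtain ⟨t, l, a, b, hl, hab, ha, hb, hch⟩ := exists_chain_of_not_isAcyclic S h
  obtain ⟨l', hl', hsub⟩ := hl.subperm fun x _ => List.mem_finRange x
  obtain ⟨r, hr⟩ := hsub.exists_perm_append
  replace hr := hr.trans (hl'.append_right r)
  have hzero : (((t :: l ++ r).map S).map (omegaOS k n)).prod = 0 := by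
    have := omegaOS_mul_prod_eq_zero_of_chain_s5 hch hab (S t) ha hb
    rw [List.map_append, List.map_append, List.prod_append, List.map_cons, List.map_cons,
      List.prod_cons, this, zero_mul]
  have hprod : (List.ofFn fun t => omegaOS k n (S t)) =
      ((List.finRange m).map S).map (omegaOS k n) := by
    rw [List.map_map, List.ofFn_eq_map]
    rfl
  rw [hprod]
  obtain ⟨q, hq⟩ := exists_prod_omegaOS_eq_smul_of_perm (hr.map S)
  rw [hq, hzero, smul_zero]

end Cycles

theorem adjoin_range_omegaOS (k n : ℕ) :
    Algebra.adjoin ℚ (Set.range (omegaOS k n)) = ⊤ := by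
  have : Set.range (omegaOS k n) =
      RingQuot.mkAlgHom ℚ (OSRel k n) '' Set.range (ι ℚ (X := OSGen k n)) := by
    rw [← Set.range_comp]
    rfl
  rw [this, ← AlgHom.map_adjoin, FreeAlgebra.adjoin_range_ι, Algebra.map_top,
    AlgHom.range_eq_top]
  exact RingQuot.mkAlgHom_surjective ℚ (OSRel k n)

/-- Every element of `A^k(n)` is a `ℚ`-linear combination of `1` and of
products `ω_{S₁} ⋯ ω_{S_m}` (with `m ≥ 1`) whose associated bipartite graph is acyclic,
i.e. a forest. -/
theorem os_spanned_by_forests (k n : ℕ) (hk : 1 ≤ k) (x : OSAlg k n) :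
    x ∈ Submodule.span ℚ
      ({1} ∪
        { y : OSAlg k n |
          ∃ (m : ℕ) (S : Fin m → OSGen k n),
            1 ≤ m ∧ (bipGraph k n S).IsAcyclic ∧
            y = (List.ofFn fun t => omegaOS k n (S t)).prod }) := by
  have hx : x ∈ Subalgebra.toSubmodule (Algebra.adjoin ℚ (Set.range (omegaOS k n))) := by
    rw [adjoin_range_omegaOS]
    trivial
  rw [Algebra.adjoin_eq_span] at hx
  refine Submodule.span_le.2 ?_ hx
  intro y hy
  obtain ⟨L, hL, rfl⟩ := Submonoid.exists_list_of_mem_closure hy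
  obtain ⟨L, rfl⟩ : ∃ L' : List (OSGen k n), L'.map (omegaOS k n) = L :=
    (Set.range_list_map (omegaOS k n)).ge hL
  have hprod : (L.map (omegaOS k n)).prod =
      (List.ofFn fun t => omegaOS k n (L.get t)).prod := by
    congr 1
    apply List.ext_getElem <;> simp
  by_cases hac : (bipGraph k n L.get).IsAcyclic
  · apply Submodule.subset_span
    rcases Nat.eq_zero_or_pos L.length with h0 | hpos
    · left
      simp [List.length_eq_zero_iff.1 h0]
    · exact .inr ⟨L.length, L.get, hpos, hac, hprod⟩
  · rw [hprod, prod_omegaOS_eq_zero_of_not_isAcyclic _ hac]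
    exact Submodule.zero_mem _
end

section
/- R_L equals the orthogonal complement of R_A in V ⊗ V with respect to the given bilinear form: R_L = R_A^⊥. (This is the quadratic duality between the generalized Orlik–Solomon algebra 𝒜^k_d(n) and the generalized Drinfeld–Kohno Lie algebra 𝔱^k_d(n): the quadratic algebra with generators V and relation space R_A and the quadratic algebra with generators V* and relation space R_L are quadratic dual to each other.) -/
/-- The space `V ⊗ V`, where `V` is the `ℚ`-vector space with basis `(e_S)_{S ∈ B(k,n)}`:
it is modelled as the space of `ℚ`-valued functions on pairs `(S,T)`, so that the tensors
`e_S ⊗ e_T` form a basis. -/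
abbrev TensorSq (k n : ℕ) := OSGen k n × OSGen k n → ℚ

/-- The basis tensor `e_S ⊗ e_T` of `V ⊗ V`. -/
def eTensor (k n : ℕ) (S T : OSGen k n) : TensorSq k n :=
  fun p => if p = (S, T) then 1 else 0

/-- The symmetric bilinear form on `V ⊗ V` for which the tensors `e_S ⊗ e_T` form an
orthonormal basis. -/
def bform (k n : ℕ) (f g : TensorSq k n) : ℚ := ∑ p, f p * g p

/-- The degree-2 relations of the (even) generalized Orlik–Solomon algebra `𝒜^k(n)`:
(i) `e_S ⊗ e_T + e_T ⊗ e_S`; (ii) `e_S ⊗ e_T` for `|S ∩ T| ≥ 2`; (iii) the cyclic sums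
`∑_{m} e_{i({m,…,m+k})} ⊗ e_{i({m+k,…,m+2k})}` for injective `i : ℤ/(2k+1) → {1,…,n}`. -/
def RAset (k n : ℕ) : Set (TensorSq k n) :=
  { x | (∃ S T, x = eTensor k n S T + eTensor k n T S) ∨
        (∃ S T, 2 ≤ (S.1 ∩ T.1).card ∧ x = eTensor k n S T) ∨
        (∃ i : ZMod (2 * k + 1) → Fin n, Function.Injective i ∧
          ∃ A : ZMod (2 * k + 1) → OSGen k n,
            (∀ m : ZMod (2 * k + 1),
              (A m).1 = (Finset.range (k + 1)).image
                fun j : ℕ => i (m + (j : ZMod (2 * k + 1)))) ∧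
            x = ∑ m : ZMod (2 * k + 1),
                  eTensor k n (A m) (A (m + (k : ZMod (2 * k + 1))))) }

/-- The relation space `R_A ⊆ V ⊗ V` of the generalized Orlik–Solomon algebra. -/
def RA (k n : ℕ) : Submodule ℚ (TensorSq k n) := Submodule.span ℚ (RAset k n)

/-- The relations of the (even) generalized Drinfeld–Kohno Lie algebra `𝔱^k(n)`:
(a) `e_S ⊗ e_T − e_T ⊗ e_S` for `S ∩ T = ∅`;
(b) `∑_{s ∈ I} (e_I ⊗ e_{(J∖{t})∪{s}} − e_{(J∖{t})∪{s}} ⊗ e_I)` for `I ∩ J = {t}`. -/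
def RLset (k n : ℕ) : Set (TensorSq k n) :=
  { x | (∃ S T, Disjoint S.1 T.1 ∧ x = eTensor k n S T - eTensor k n T S) ∨
        (∃ (I J : OSGen k n) (t : Fin n), I.1 ∩ J.1 = {t} ∧
          ∃ K : {s // s ∈ I.1} → OSGen k n,
            (∀ s, (K s).1 = insert s.1 (J.1.erase t)) ∧
            x = ∑ s : {s // s ∈ I.1},
                  (eTensor k n I (K s) - eTensor k n (K s) I)) }

/-- The relation space `R_L ⊆ V ⊗ V` of the generalized Drinfeld–Kohno Lie algebra. -/
def RL (k n : ℕ) : Submodule ℚ (TensorSq k n) := Submodule.span ℚ (RLset k n)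

theorem exists_potential {α : Type*} [DecidableEq α] (U : Finset α) :
    ∀ (K : ℕ) (F : Finset α → Finset α → ℚ), (∀ X Y, F X Y = -F Y X) →
      (∀ E ⊆ U, E.card = K → ∀ a ∈ U, ∀ b ∈ U, ∀ c ∈ U, a ∉ E → b ∉ E → c ∉ E →
        F (insert a E) (insert b E) + F (insert b E) (insert c E) =
          F (insert a E) (insert c E)) →
      (∀ D ⊆ U, D.card = K + 2 → ∀ a ∈ D, ∀ b ∈ D, ∀ c ∈ D,
        F (D.erase a) (D.erase b) + F (D.erase b) (D.erase c) = F (D.erase a) (D.erase c)) →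
      ∃ φ : Finset α → ℚ, ∀ E ⊆ U, E.card = K → ∀ a ∈ U, ∀ b ∈ U, a ∉ E → b ∉ E →
        F (insert a E) (insert b E) = φ (insert b E) - φ (insert a E) := by
  induction U using Finset.induction_on with
  | empty =>
    intro K F _ _ _
    exact ⟨0, fun E _ _ a ha => absurd ha (Finset.notMem_empty a)⟩
  | insert p U hp ih =>
    intro K F hF hE hD
    have hself : ∀ X, F X X = 0 := fun X => by linarith [hF X X]
    obtain ⟨φ₁, h₁⟩ := ih K F hF
      (fun E hEU hc a ha b hb c hc' => hE E (hEU.trans (Finset.subset_insert _ _)) hc a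
        (Finset.mem_insert_of_mem ha) b (Finset.mem_insert_of_mem hb) c
        (Finset.mem_insert_of_mem hc'))
      (fun D hDU => hD D (hDU.trans (Finset.subset_insert _ _)))
    obtain ⟨φ₂, h₂⟩ : ∃ φ₂ : Finset α → ℚ, ∀ E ⊆ U, E.card + 1 = K → ∀ a ∈ U, ∀ b ∈ U,
        a ∉ E → b ∉ E → F (insert p (insert a E)) (insert p (insert b E)) =
          φ₂ (insert b E) - φ₂ (insert a E) := by
      rcases K with _ | K
      · exact ⟨0, fun E _ h => absurd h (by omega)⟩
      obtain ⟨φ, h⟩ := ih K (fun X Y => F (insert p X) (insert p Y)) (fun X Y => hF _ _)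
        (by
          intro E hEU hc a ha b hb c hc' haE hbE hcE
          have hpE : p ∉ E := fun h => hp (hEU h)
          have key := hE (insert p E) (Finset.insert_subset_insert _ hEU)
            (by rw [Finset.card_insert_of_notMem hpE, hc]) a
            (Finset.mem_insert_of_mem ha) b (Finset.mem_insert_of_mem hb) c
            (Finset.mem_insert_of_mem hc') (by clear * - hpE haE ha hp; grind)
              (by clear * - hpE hbE hb hp; grind)
            (by clear * - hpE hcE hc' hp; grind)
          simpa only [Finset.insert_comm _ p] using key)
        (by
          intro D hDU hc a ha b hb c hc'
          have hpD : p ∉ D := fun h => hp (hDU h)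
          have key := hD (insert p D) (Finset.insert_subset_insert _ hDU)
            (by rw [Finset.card_insert_of_notMem hpD, hc]) a
            (Finset.mem_insert_of_mem ha) b (Finset.mem_insert_of_mem hb) c
            (Finset.mem_insert_of_mem hc')
          rwa [Finset.erase_insert_of_ne (ne_of_mem_of_not_mem ha hpD).symm,
            Finset.erase_insert_of_ne (ne_of_mem_of_not_mem hb hpD).symm,
            Finset.erase_insert_of_ne (ne_of_mem_of_not_mem hc' hpD).symm] at key)
      exact ⟨φ, fun E hEU hc => h E hEU (by omega)⟩
    -- the discrepancy between the two potentials across an edge is constant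
    obtain ⟨c₀, hc₀⟩ : ∃ c₀ : ℚ, ∀ E ⊆ U, E.card = K → ∀ a ∈ U, a ∉ E →
        F (insert a E) (insert p E) + φ₁ (insert a E) - φ₂ E = c₀ := by
      have hA : ∀ E ⊆ U, E.card = K → ∀ a ∈ U, a ∉ E → ∀ b ∈ U, b ∉ E →
          F (insert a E) (insert p E) + φ₁ (insert a E) - φ₂ E =
          F (insert b E) (insert p E) + φ₁ (insert b E) - φ₂ E := by
        intro E hEU hc a ha haE b hb hbE
        have := hE E (hEU.trans (Finset.subset_insert _ _)) hc a
          (Finset.mem_insert_of_mem ha) b (Finset.mem_insert_of_mem hb) p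
          (Finset.mem_insert_self _ _) haE hbE (fun h => hp (hEU h))
        have := h₁ E hEU hc a ha b hb haE hbE
        linarith
      have hB : ∀ E ⊆ U, E.card + 1 = K → ∀ a ∈ U, a ∉ E → ∀ b ∈ U, b ∉ E → a ≠ b →
          F (insert b (insert a E)) (insert p (insert a E)) + φ₁ (insert b (insert a E))
            - φ₂ (insert a E) =
          F (insert a (insert b E)) (insert p (insert b E)) + φ₁ (insert a (insert b E))
            - φ₂ (insert b E) := by
        intro E hEU hc a ha haE b hb hbE hab
        have hpE : p ∉ E := fun h => hp (hEU h)
        have hpa : p ≠ a := fun h => hp (h ▸ ha)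
        have hpb : p ≠ b := fun h => hp (h ▸ hb)
        have e₁ : (insert p (insert a (insert b E))).erase p = insert a (insert b E) := by
          clear * - hp hEU hc haE hbE hab hpE hpa hpb ha hb
          grind
        have e₂ : (insert p (insert a (insert b E))).erase a = insert p (insert b E) := by
          clear * - hp hEU hc haE hbE hab hpE hpa hpb ha hb
          grind
        have e₃ : (insert p (insert a (insert b E))).erase b = insert p (insert a E) := by
          clear * - hp hEU hc haE hbE hab hpE hpa hpb ha hb
          grind
        have key := hD (insert p (insert a (insert b E)))
          (by clear * - hp hEU hc haE hbE hab hpE hpa hpb ha hb; grind)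
          (by clear * - hp hEU hc haE hbE hab hpE hpa hpb ha hb; grind) p
            (by clear * - hp hEU hc haE hbE hab hpE hpa hpb ha hb; grind) a
            (by clear * - hp hEU hc haE hbE hab hpE hpa hpb ha hb; grind) b
            (by clear * - hp hEU hc haE hbE hab hpE hpa hpb ha hb; grind)
        rw [e₁, e₂, e₃] at key
        have := h₂ E hEU hc b hb a ha hbE haE
        rw [Finset.insert_comm b a]
        linarith
      by_cases hex : ∃ E₀ a₀, E₀ ⊆ U ∧ E₀.card = K ∧ a₀ ∈ U ∧ a₀ ∉ E₀
      · obtain ⟨E₀, a₀, hE₀, hK₀, ha₀, haE₀⟩ := hex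
        refine ⟨F (insert a₀ E₀) (insert p E₀) + φ₁ (insert a₀ E₀) - φ₂ E₀, ?_⟩
        suffices H : ∀ m : ℕ, ∀ E ⊆ U, E.card = K → (E \ E₀).card = m → ∀ a ∈ U, a ∉ E →
            F (insert a E) (insert p E) + φ₁ (insert a E) - φ₂ E =
            F (insert a₀ E₀) (insert p E₀) + φ₁ (insert a₀ E₀) - φ₂ E₀ from
          fun E hEU hc a ha haE => H _ E hEU hc rfl a ha haE
        intro m
        induction m with
        | zero =>
          intro E hEU hc hm a ha haE
          have hsub : E ⊆ E₀ := by
            rw [Finset.card_eq_zero] at hm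
            exact Finset.sdiff_eq_empty_iff_subset.mp hm
          obtain rfl := Finset.eq_of_subset_of_card_le hsub (by omega)
          exact hA E hEU hc a ha haE a₀ ha₀ haE₀
        | succ m ihm =>
          intro E hEU hc hm a ha haE
          obtain ⟨b, hb⟩ := Finset.card_pos.mp (by omega : 0 < (E \ E₀).card)
          have hm' : (E₀ \ E).card = m + 1 := by
            rw [← hm, Finset.card_sdiff_comm (by omega)]
          obtain ⟨a', ha'⟩ := Finset.card_pos.mp (by omega : 0 < (E₀ \ E).card)
          rw [Finset.mem_sdiff] at hb ha'
          have hbU := hEU hb.1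
          have haU := hE₀ ha'.1
          rw [hA E hEU hc a ha haE a' haU ha'.2]
          have hcE := Finset.card_erase_add_one hb.1
          have := hB (E.erase b) ((Finset.erase_subset _ _).trans hEU) (by omega) b hbU
            (Finset.notMem_erase _ _) a' haU
              (by clear * - hp hEU hc ha haE hb ha' hbU haU hcE; grind)
              (by clear * - hp hEU hc ha haE hb ha' hbU haU hcE; grind)
          rw [Finset.insert_erase hb.1] at this
          rw [this]
          refine ihm _ (by clear * - hp hEU hc ha haE hb ha' hbU haU hcE; grind)
            (by clear * - hp hEU hc ha haE hb ha' hbU haU hcE; grind) ?_ b hbU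
            (by clear * - hp hEU hc ha haE hb ha' hbU haU hcE; grind)
          have : (insert a' (E.erase b)) \ E₀ = (E \ E₀).erase b := by
            clear * - hp hEU hc ha haE hb ha' hbU haU hcE
            grind
          rw [this, Finset.card_erase_of_mem
            (by clear * - hp hEU hc ha haE hb ha' hbU haU hcE; grind), hm]
          rfl
      · refine ⟨0, fun E hEU hc a ha haE => absurd ⟨E, a, hEU, hc, ha, haE⟩ hex⟩
    refine ⟨fun X => if p ∈ X then φ₂ (X.erase p) + c₀ else φ₁ X, ?_⟩
    intro E hEU hc a ha b hb haE hbE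
    by_cases hab : a = b
    · subst hab; simp [hself]
    have hcross : ∀ a ∈ U, a ∉ E → p ∉ E → F (insert a E) (insert p E) =
        (φ₂ ((insert p E).erase p) + c₀) - φ₁ (insert a E) := by
      intro a ha haE hpE
      have := hc₀ E (by clear * - hp hEU hpE; grind) hc a ha haE
      rw [Finset.erase_insert hpE]
      linarith
    by_cases hpE : p ∈ E
    · have hca := Finset.card_erase_add_one hpE
      have key := h₂ (E.erase p) (by clear * - hp hEU hc ha hb haE hbE hpE; grind) (by omega) a
        (by clear * - hp hEU hc ha hb haE hbE hpE; grind) b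
        (by clear * - hp hEU hc ha hb haE hbE hpE; grind)
        (by clear * - hp hEU hc ha hb haE hbE hpE; grind)
        (by clear * - hp hEU hc ha hb haE hbE hpE; grind)
      have e : ∀ x, x ≠ p → (insert x E).erase p = insert x (E.erase p) :=
        fun x hx => Finset.erase_insert_of_ne hx
      have e' : ∀ x, insert p (insert x (E.erase p)) = insert x E := fun x => by
        rw [Finset.insert_comm, Finset.insert_erase hpE]
      rw [e', e'] at key
      simp only [Finset.mem_insert, hpE, or_true, if_true]
      rw [e a (by clear * - hp hEU hc ha hb haE hbE hpE; grind), e b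
        (by clear * - hp hEU hc ha hb haE hbE hpE; grind), key]
      ring
    · by_cases hpa : a = p
      · subst hpa
        have := hcross b (by clear * - hp hEU hb hab; grind) hbE hpE
        have h' := hF (insert a E) (insert b E)
        simp only [Finset.mem_insert, hpE, hab, or_false, if_true, if_false]
        linarith
      · by_cases hpb : b = p
        · subst hpb
          have := hcross a (by clear * - hp hEU ha hpa; grind) haE hpE
          simp only [Finset.mem_insert, hpE, Ne.symm hpa, or_false, if_true, if_false]
          linarith
        · simp only [Finset.mem_insert, hpE, Ne.symm hpa, Ne.symm hpb, or_false, if_false]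
          exact h₁ E (by clear * - hp hEU ha hb hpa hpb hpE; grind) hc a
            (by clear * - hp hEU ha hb hpa hpb hpE; grind) b
            (by clear * - hp hEU ha hb hpa hpb hpE; grind) haE hbE

/-- The image under `i` of the `k+1` cyclically consecutive residues starting at `m`. -/
def arc {α : Type*} [DecidableEq α] (k : ℕ) (i : ZMod (2 * k + 1) → α)
    (m : ZMod (2 * k + 1)) : Finset α :=
  (Finset.range (k + 1)).image fun j : ℕ => i (m + (j : ZMod (2 * k + 1)))

/-- The image under `w` of the `k+1` consecutive integers starting at `j`. -/
def window {α : Type*} [DecidableEq α] (k : ℕ) (w : ℕ → α) (j : ℕ) : Finset α :=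
  (Finset.Ico j (j + k + 1)).image w

/-- The value of `f` along the path from `X` to `Y` through the complement in `U` of their
intersection. -/
def twoStep {α : Type*} [DecidableEq α] (f : Finset α → Finset α → ℚ) (U X Y : Finset α) : ℚ :=
  f X (U \ (X ∩ Y)) + f (U \ (X ∩ Y)) Y

theorem sum_zmod_eq_sum_range (k : ℕ) (g : ZMod (2 * k + 1) → ℚ) :
    ∑ m, g m = ∑ j ∈ Finset.range k, (g (-(j : ZMod (2 * k + 1))) + g (k - j))
      + g (-(k : ZMod (2 * k + 1))) := by
  have h0 : ((2 * k + 1 : ℕ) : ZMod (2 * k + 1)) = 0 := ZMod.natCast_self _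
  have h1 : ∑ m, g m = ∑ j ∈ Finset.range (2 * k + 1), g (-(j : ZMod (2 * k + 1))) := by
    symm
    refine Finset.sum_bij' (fun j _ => -(j : ZMod (2 * k + 1))) (fun m _ => (-m).val)
      (fun _ _ => Finset.mem_univ _) (fun m _ => Finset.mem_range.mpr (ZMod.val_lt _))
      ?_ ?_ (fun _ _ => rfl)
    · intro j hj
      rw [neg_neg, ZMod.val_natCast, Nat.mod_eq_of_lt (Finset.mem_range.mp hj)]
    · intro m _
      rw [ZMod.natCast_zmod_val, neg_neg]
  have h2 : Finset.range (2 * k + 1) = Finset.range ((k + 1) + k) := by congr 1; ring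
  rw [h1, h2, Finset.sum_range_add, Finset.sum_range_succ, Finset.sum_add_distrib]
  have : ∀ j : ℕ, -((k + 1 + j : ℕ) : ZMod (2 * k + 1)) = k - j := by
    intro j
    push_cast at h0 ⊢
    linear_combination -h0
  simp only [this]
  ring

theorem arc_reverse {α : Type*} [DecidableEq α] (k : ℕ) (w : ℕ → α) {j : ℕ} (hj : j ≤ k) :
    arc k (fun m => w ((k : ZMod (2 * k + 1)) - m).val) (-(j : ZMod (2 * k + 1))) =
      window k w j := by
  have hv : ∀ l ∈ Finset.range (k + 1),
      ((k : ZMod (2 * k + 1)) - (-(j : ZMod (2 * k + 1)) + (l : ZMod (2 * k + 1)))).val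
        = k + j - l := by
    intro l hl
    rw [Finset.mem_range] at hl
    have : (k : ZMod (2 * k + 1)) - (-(j : ZMod (2 * k + 1)) + (l : ZMod (2 * k + 1)))
        = ((k + j - l : ℕ) : ZMod (2 * k + 1)) := by
      rw [Nat.cast_sub (by omega)]; push_cast; ring
    rw [this, ZMod.val_natCast, Nat.mod_eq_of_lt (by omega)]
  unfold arc window
  ext x
  simp only [Finset.mem_image]
  constructor
  · rintro ⟨l, hl, rfl⟩
    refine ⟨k + j - l, ?_, by rw [hv l hl]⟩
    rw [Finset.mem_range] at hl
    rw [Finset.mem_Ico]; omega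
  · rintro ⟨a, ha, rfl⟩
    rw [Finset.mem_Ico] at ha
    have hl : k + j - a ∈ Finset.range (k + 1) := by rw [Finset.mem_range]; omega
    refine ⟨k + j - a, hl, ?_⟩
    rw [hv _ hl]
    congr 1; omega

theorem window_inter_window_succ {α : Type*} [DecidableEq α] {k : ℕ} {w : ℕ → α}
    (hw : Set.InjOn w (Finset.range (2 * k + 1))) {j : ℕ} (hj : j < k) :
    window k w j ∩ window k w (j + 1) = (Finset.Ico (j + 1) (j + k + 1)).image w := by
  unfold window
  rw [← Finset.image_inter_of_injOn _ _ (hw.mono _)]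
  · congr 1
    ext a; simp only [Finset.mem_inter, Finset.mem_Ico]; omega
  · intro a
    simp only [Set.mem_union, Finset.coe_Ico, Set.mem_Ico, Finset.coe_range, Set.mem_Iio]
    omega

theorem arc_reverse_compl {α : Type*} [DecidableEq α] {k : ℕ} {w : ℕ → α}
    (hw : Set.InjOn w (Finset.range (2 * k + 1))) {j : ℕ} (hj : j < k) :
    arc k (fun m => w ((k : ZMod (2 * k + 1)) - m).val)
        ((k : ZMod (2 * k + 1)) - (j : ZMod (2 * k + 1))) =
      (Finset.range (2 * k + 1)).image w \ (window k w j ∩ window k w (j + 1)) := by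
  have h0 : ((2 * k + 1 : ℕ) : ZMod (2 * k + 1)) = 0 := ZMod.natCast_self _
  have hv : ∀ l ∈ Finset.range (k + 1),
      ((k : ZMod (2 * k + 1)) -
        ((k : ZMod (2 * k + 1)) - (j : ZMod (2 * k + 1)) + (l : ZMod (2 * k + 1)))).val
        = if l ≤ j then j - l else 2 * k + 1 + j - l := by
    intro l hl
    rw [Finset.mem_range] at hl
    have : (k : ZMod (2 * k + 1)) -
        ((k : ZMod (2 * k + 1)) - (j : ZMod (2 * k + 1)) + (l : ZMod (2 * k + 1)))
        = ((if l ≤ j then j - l else 2 * k + 1 + j - l : ℕ) : ZMod (2 * k + 1)) := by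
      split_ifs
      · rw [Nat.cast_sub (by omega)]; ring
      · rw [Nat.cast_sub (by omega), Nat.cast_add, h0]; ring
    rw [this, ZMod.val_natCast, Nat.mod_eq_of_lt (by split_ifs <;> omega)]
  rw [window_inter_window_succ hw hj,
    ← Finset.image_sdiff_of_injOn hw
      (by intro a; simp only [Finset.mem_Ico, Finset.mem_range]; omega)]
  unfold arc
  ext x
  simp only [Finset.mem_image, Finset.mem_sdiff, Finset.mem_Ico]
  constructor
  · rintro ⟨l, hl, rfl⟩
    refine ⟨_, ?_, by rw [hv l hl]⟩
    rw [Finset.mem_range] at hl ⊢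
    split_ifs <;> omega
  · rintro ⟨a, ⟨ha, ha'⟩, rfl⟩
    rw [Finset.mem_range] at ha
    by_cases h : a ≤ j
    · have hl : j - a ∈ Finset.range (k + 1) := by rw [Finset.mem_range]; omega
      refine ⟨j - a, hl, ?_⟩
      rw [hv _ hl, if_pos (by omega)]
      congr 1; omega
    · have hl : 2 * k + 1 + j - a ∈ Finset.range (k + 1) := by rw [Finset.mem_range]; omega
      refine ⟨2 * k + 1 + j - a, hl, ?_⟩
      rw [hv _ hl, if_neg (by omega)]
      congr 1; omega

theorem sum_twoStep_window {α : Type*} [DecidableEq α] {k : ℕ} {f : Finset α → Finset α → ℚ}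
    (hf : ∀ i : ZMod (2 * k + 1) → α, Function.Injective i →
      ∑ m : ZMod (2 * k + 1), f (arc k i m) (arc k i (m + (k : ZMod (2 * k + 1)))) = 0)
    {w : ℕ → α} (hw : Set.InjOn w (Finset.range (2 * k + 1))) :
    ∑ j ∈ Finset.range k, twoStep f ((Finset.range (2 * k + 1)).image w)
      (window k w j) (window k w (j + 1)) + f (window k w k) (window k w 0) = 0 := by
  have h0 : ((2 * k + 1 : ℕ) : ZMod (2 * k + 1)) = 0 := ZMod.natCast_self _
  have hinj : Function.Injective fun m => w ((k : ZMod (2 * k + 1)) - m).val := by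
    intro a b hab
    have := hw (Finset.mem_coe.mpr (Finset.mem_range.mpr (ZMod.val_lt _)))
      (Finset.mem_coe.mpr (Finset.mem_range.mpr (ZMod.val_lt _))) hab
    exact sub_right_injective (ZMod.val_injective _ this)
  rw [← hf _ hinj, sum_zmod_eq_sum_range]
  congr 1
  · refine Finset.sum_congr rfl fun j hj => ?_
    rw [Finset.mem_range] at hj
    have e₁ : -(j : ZMod (2 * k + 1)) + k = k - j := by ring
    have e₂ : (k : ZMod (2 * k + 1)) - j + k = -((j + 1 : ℕ) : ZMod (2 * k + 1)) := by
      push_cast at h0 ⊢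
      linear_combination h0
    rw [e₁, e₂, arc_reverse k w hj.le, arc_reverse k w (Nat.succ_le_of_lt hj),
      arc_reverse_compl hw hj]
    rfl
  · have e : -(k : ZMod (2 * k + 1)) + k = -((0 : ℕ) : ZMod (2 * k + 1)) := by simp
    rw [e, arc_reverse k w le_rfl, arc_reverse k w (Nat.zero_le _)]

theorem image_getD_append {α : Type*} [DecidableEq α] (L₁ L₂ L₃ : List α) (d : α) :
    (Finset.Ico L₁.length (L₁.length + L₂.length)).image
      (fun j => (L₁ ++ L₂ ++ L₃).getD j d) = L₂.toFinset := by
  ext x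
  simp only [Finset.mem_image, Finset.mem_Ico, List.mem_toFinset]
  have key : ∀ j, j < L₂.length →
      (L₁ ++ L₂ ++ L₃).getD (L₁.length + j) d = L₂.getD j d := by
    intro j hj
    rw [List.append_assoc, List.getD_append_right _ _ _ _ (by omega),
      List.getD_append _ _ _ _ (by omega), Nat.add_sub_cancel_left]
  constructor
  · rintro ⟨j, ⟨h₁, h₂⟩, rfl⟩
    obtain ⟨l, rfl⟩ := Nat.exists_eq_add_of_le h₁
    rw [key l (by omega), List.getD_eq_getElem _ _ (by omega)]
    exact List.getElem_mem _
  · intro hx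
    obtain ⟨l, hl, rfl⟩ := List.mem_iff_getElem.mp hx
    exact ⟨L₁.length + l, ⟨by omega, by omega⟩, by
      rw [key l hl, List.getD_eq_getElem _ _ hl]⟩

theorem injOn_getD {α : Type*} {L : List α} (hL : L.Nodup) (d : α) :
    Set.InjOn (fun j => L.getD j d) (Finset.range L.length) := by
  intro a ha b hb hab
  simp only [Finset.coe_range, Set.mem_Iio] at ha hb
  simp only [List.getD_eq_getElem _ _ ha, List.getD_eq_getElem _ _ hb] at hab
  exact (hL.getElem_inj_iff).mp hab

theorem window_eq_insert {α : Type*} [DecidableEq α] (k : ℕ) (w : ℕ → α) (j : ℕ) :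
    window k w j = insert (w j) ((Finset.Ico (j + 1) (j + k + 1)).image w) := by
  rw [window, ← Finset.image_insert, Finset.insert_Ico_add_one_left_eq_Ico (by omega)]

theorem window_succ_eq_insert {α : Type*} [DecidableEq α] (k : ℕ) (w : ℕ → α) (j : ℕ) :
    window k w (j + 1) =
      insert (w (j + k + 1)) ((Finset.Ico (j + 1) (j + k + 1)).image w) := by
  rw [window, ← Finset.image_insert]
  congr 1
  ext a
  simp only [Finset.mem_Ico, Finset.mem_insert]
  omega

section

variable {α : Type*} [DecidableEq α] {f : Finset α → Finset α → ℚ}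

theorem twoStep_antisymm (hf : ∀ X Y, f X Y = -f Y X) (U X Y : Finset α) :
    twoStep f U X Y = -twoStep f U Y X := by
  unfold twoStep
  rw [Finset.inter_comm Y X]
  linarith [hf X (U \ (X ∩ Y)), hf Y (U \ (X ∩ Y))]

theorem twoStep_insert (hf : ∀ X Y, f X Y = -f Y X) (U : Finset α) {E : Finset α} {a b : α}
    (hb : b ∉ E) :
    twoStep f U (insert a E) (insert b E) = f (insert a E) (U \ E) + f (U \ E) (insert b E) := by
  by_cases hab : a = b
  · subst hab
    linarith [twoStep_antisymm hf U (insert a E) (insert a E), hf (insert a E) (U \ E)]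
  · have : insert a E ∩ insert b E = E := by clear * - hb hab; grind
    rw [twoStep, this]

theorem twoStep_insert_trans (hf : ∀ X Y, f X Y = -f Y X) (U : Finset α) {E : Finset α}
    {a b c : α} (hb : b ∉ E) (hc : c ∉ E) :
    twoStep f U (insert a E) (insert b E) + twoStep f U (insert b E) (insert c E) =
      twoStep f U (insert a E) (insert c E) := by
  rw [twoStep_insert hf U hb, twoStep_insert hf U hc, twoStep_insert hf U hc]
  linarith [hf (insert b E) (U \ E)]

theorem notMem_image_of_injOn {w : ℕ → α} {s t : Finset ℕ} (hw : Set.InjOn w s) (ht : t ⊆ s)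
    {a : ℕ} (ha : a ∈ s) (hat : a ∉ t) : w a ∉ t.image w := by
  intro h
  obtain ⟨b, hb, hab⟩ := Finset.mem_image.mp h
  exact hat (hw (ht hb) ha hab ▸ hb)

theorem window_comp_swap {k : ℕ} (w : ℕ → α) {j : ℕ} (hj : j = 0 ∨ 2 ≤ j ∧ j ≤ k) :
    window k (w ∘ Equiv.swap (k + 1) (k + 2)) j = window k w j := by
  rw [window, window, ← Finset.image_image]
  congr 1
  ext a
  simp only [Finset.mem_image, Finset.mem_Ico]
  constructor
  · rintro ⟨b, hb, rfl⟩
    rw [Equiv.swap_apply_def]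
    split_ifs <;> omega
  · intro ha
    refine ⟨Equiv.swap (k + 1) (k + 2) a, ?_, Equiv.swap_apply_self _ _ _⟩
    rw [Equiv.swap_apply_def]
    split_ifs <;> omega

theorem twoStep_erase_trans_of_enum {k : ℕ} (hk : 2 ≤ k) (hf : ∀ X Y, f X Y = -f Y X)
    (hc : ∀ i : ZMod (2 * k + 1) → α, Function.Injective i →
      ∑ m : ZMod (2 * k + 1), f (arc k i m) (arc k i (m + (k : ZMod (2 * k + 1)))) = 0)
    {w : ℕ → α} (hw : Set.InjOn w (Finset.range (2 * k + 1))) {U D : Finset α}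
    (hU : (Finset.range (2 * k + 1)).image w = U) (hD : (Finset.Ico 1 (k + 3)).image w = D) :
    twoStep f U (D.erase (w (k + 1))) (D.erase (w (k + 2))) +
      twoStep f U (D.erase (w (k + 2))) (D.erase (w 1)) =
      twoStep f U (D.erase (w (k + 1))) (D.erase (w 1)) := by
  set σ := Equiv.swap (k + 1) (k + 2) with hσ
  have hσr : (Finset.range (2 * k + 1)).image σ = Finset.range (2 * k + 1) := by
    ext a
    simp only [Finset.mem_image, Finset.mem_range]
    constructor
    · rintro ⟨b, hb, rfl⟩
      rw [hσ, Equiv.swap_apply_def]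
      split_ifs <;> omega
    · intro ha
      refine ⟨σ a, ?_, Equiv.swap_apply_self _ _ _⟩
      rw [hσ, Equiv.swap_apply_def]
      split_ifs <;> omega
  have hw' : Set.InjOn (w ∘ σ) (Finset.range (2 * k + 1)) := by
    refine hw.comp σ.injective.injOn fun a ha => ?_
    rw [← hσr]
    exact Finset.mem_coe.mpr (Finset.mem_image_of_mem _ ha)
  have hU' : (Finset.range (2 * k + 1)).image (w ∘ σ) = U := by
    rw [← Finset.image_image, hσr, hU]
  have s₁ := sum_twoStep_window hc hw
  have s₂ := sum_twoStep_window hc hw'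
  rw [hU] at s₁
  rw [hU'] at s₂
  obtain ⟨l, rfl⟩ := Nat.exists_eq_add_of_le hk
  rw [Finset.sum_range_add, Finset.sum_range_succ, Finset.sum_range_succ, Finset.sum_range_zero]
    at s₁ s₂
  have hwin : ∀ j, j = 0 ∨ 2 ≤ j ∧ j ≤ 2 + l →
      window (2 + l) (w ∘ σ) j = window (2 + l) w j := fun j hj => window_comp_swap w hj
  have hrest : ∀ j ∈ Finset.range l,
      twoStep f U (window (2 + l) (w ∘ σ) (2 + j)) (window (2 + l) (w ∘ σ) (2 + j + 1)) =
      twoStep f U (window (2 + l) w (2 + j)) (window (2 + l) w (2 + j + 1)) := by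
    intro j hj
    rw [Finset.mem_range] at hj
    rw [hwin (2 + j) (by omega), hwin (2 + j + 1) (by omega)]
  rw [Finset.sum_congr rfl hrest, hwin 0 (by omega), hwin (1 + 1) (by omega),
    hwin (2 + l) (by omega)] at s₂
  set E := (Finset.Ico 1 (2 + l + 1)).image w with hE
  have hErange : Finset.Ico 1 (2 + l + 1) ⊆ Finset.range (2 * (2 + l) + 1) := fun a => by
    simp only [Finset.mem_Ico, Finset.mem_range]; omega
  have hEσ : (Finset.Ico 1 (2 + l + 1)).image (w ∘ σ) = E := by
    refine Finset.image_congr fun a ha => ?_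
    rw [Finset.mem_coe, Finset.mem_Ico] at ha
    rw [Function.comp_apply, hσ, Equiv.swap_apply_of_ne_of_ne (by omega) (by omega)]
  have hE₁ : w (2 + l + 1) ∉ E :=
    notMem_image_of_injOn hw hErange (Finset.mem_range.mpr (by omega)) (by simp)
  have hE₂ : w (2 + l + 2) ∉ E :=
    notMem_image_of_injOn hw hErange (Finset.mem_range.mpr (by omega)) (by simp)
  have hne : w (2 + l + 1) ≠ w (2 + l + 2) := fun h => by
    have := hw (Finset.mem_coe.mpr (Finset.mem_range.mpr (by omega)))
      (Finset.mem_coe.mpr (Finset.mem_range.mpr (by omega))) h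
    omega
  have v₀ : window (2 + l) w 0 = insert (w 0) E := by
    rw [window_eq_insert]; simp only [zero_add, hE]
  have v₁ : window (2 + l) w (0 + 1) = insert (w (2 + l + 1)) E := by
    rw [window_succ_eq_insert]; simp only [zero_add, hE]
  have v₁' : window (2 + l) (w ∘ σ) (0 + 1) = insert (w (2 + l + 2)) E := by
    rw [window_succ_eq_insert]
    simp only [zero_add, hEσ]
    rw [Function.comp_apply, hσ, Equiv.swap_apply_left]
  have hDE : D = insert (w (2 + l + 2)) (insert (w (2 + l + 1)) E) := by
    rw [← hD, hE, ← Finset.image_insert, ← Finset.image_insert]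
    congr 1
    ext a
    simp only [Finset.mem_Ico, Finset.mem_insert]
    omega
  have d₁ : D.erase (w (2 + l + 1)) = insert (w (2 + l + 2)) E := by
    rw [hDE]; clear * - hE₁ hne; grind
  have d₂ : D.erase (w (2 + l + 2)) = insert (w (2 + l + 1)) E := by
    rw [hDE]; clear * - hE₂ hne; grind
  have d₃ : D.erase (w 1) = window (2 + l) w 2 := by
    have : D = insert (w 1) (window (2 + l) w 2) := by
      rw [← hD, window, ← Finset.image_insert]
      congr 1
      ext a
      simp only [Finset.mem_Ico, Finset.mem_insert]
      omega
    rw [this, Finset.erase_insert]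
    refine notMem_image_of_injOn hw (fun a => ?_) (Finset.mem_range.mpr (by omega)) (by simp)
    simp only [Finset.mem_Ico, Finset.mem_range]; omega
  rw [d₁, d₂, d₃]
  rw [v₀, v₁, show 1 + 1 = 2 from rfl] at s₁
  rw [v₀, v₁', show 1 + 1 = 2 from rfl] at s₂
  have t := twoStep_insert_trans (a := w 0) hf U hE₂ hE₁
  simp only [zero_add] at s₁ s₂
  linarith

theorem twoStep_erase_trans {k : ℕ} (hk : 1 ≤ k) (hf : ∀ X Y, f X Y = -f Y X)
    (hc : ∀ i : ZMod (2 * k + 1) → α, Function.Injective i →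
      ∑ m : ZMod (2 * k + 1), f (arc k i m) (arc k i (m + (k : ZMod (2 * k + 1)))) = 0)
    {U D : Finset α} (hU : U.card = 2 * k + 1) (hDU : D ⊆ U) (hD : D.card = k + 2)
    {p q r : α} (hp : p ∈ D) (hq : q ∈ D) (hr : r ∈ D) :
    twoStep f U (D.erase p) (D.erase q) + twoStep f U (D.erase q) (D.erase r) =
      twoStep f U (D.erase p) (D.erase r) := by
  have anti := twoStep_antisymm hf U
  by_cases hpq : p = q
  · subst hpq; linarith [anti (D.erase p) (D.erase p)]
  by_cases hqr : q = r
  · subst hqr; linarith [anti (D.erase q) (D.erase q)]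
  by_cases hpr : p = r
  · subst hpr; linarith [anti (D.erase p) (D.erase p), anti (D.erase p) (D.erase q)]
  obtain rfl | hk2 : k = 1 ∨ 2 ≤ k := by omega
  · obtain rfl : D = U := Finset.eq_of_subset_of_card_le hDU (by omega)
    have hDeq : D = {p, q, r} := by
      symm
      refine Finset.eq_of_subset_of_card_le (by clear * - hp hq hr; grind) ?_
      rw [hD, Finset.card_eq_three.mpr ⟨p, q, r, hpq, hpr, hqr, rfl⟩]
    have two : ∀ a b c, a ≠ b → a ≠ c → b ≠ c → D = {a, b, c} →
        twoStep f D (D.erase a) (D.erase b) =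
          f (D.erase a) (D.erase c) + f (D.erase c) (D.erase b) := by
      intro a b c hab hac hbc h
      have e : D.erase a ∩ D.erase b = {c} := by rw [h]; clear * - hab hac hbc; grind
      rw [twoStep, e, ← Finset.erase_eq]
    have hL : [p, q, r].Nodup := by simp [hpq, hpr, hqr]
    have s := sum_twoStep_window hc (injOn_getD hL p)
    have hr0 : (Finset.range (2 * 1 + 1)).image (fun j => [p, q, r].getD j p) = D := by
      rw [Finset.range_eq_Ico]
      refine (image_getD_append [] [p, q, r] [] p).trans ?_
      rw [hDeq]; simp
    have hw0 : window 1 (fun j => [p, q, r].getD j p) 0 = D.erase r := by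
      refine (image_getD_append [] [p, q] [r] p).trans ?_
      rw [hDeq]; clear * - hpq hpr hqr; simp; grind
    have hw1 : window 1 (fun j => [p, q, r].getD j p) 1 = D.erase p := by
      refine (image_getD_append [p] [q, r] [] p).trans ?_
      rw [hDeq]; clear * - hpq hpr hqr; simp; grind
    rw [hr0, Finset.sum_range_one, zero_add, hw0, hw1] at s
    rw [two r p q (Ne.symm hpr) (Ne.symm hqr) hpq (by rw [hDeq]; clear * -; grind)] at s
    rw [two p q r hpq hpr hqr hDeq,
      two q r p hqr (Ne.symm hpq) (Ne.symm hpr) (by rw [hDeq]; clear * -; grind),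
      two p r q hpr hpq (Ne.symm hqr) (by rw [hDeq]; clear * -; grind)]
    linarith [hf (D.erase p) (D.erase q), hf (D.erase q) (D.erase r),
      hf (D.erase r) (D.erase p)]
  · obtain ⟨e, heU, heD⟩ : ∃ e ∈ U, e ∉ D := Finset.exists_mem_notMem_of_card_lt_card (by omega)
    set R := ((D.erase p).erase q).erase r with hR
    set M := U \ insert e D with hM
    have hRc : R.card = k - 1 := by
      rw [hR, Finset.card_erase_of_mem (by clear * - hr hpr hqr; grind),
        Finset.card_erase_of_mem (by clear * - hq hpq; grind), Finset.card_erase_of_mem hp, hD]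
      omega
    have hMc : M.card = k - 2 := by
      rw [hM, Finset.card_sdiff_of_subset (Finset.insert_subset heU hDU),
        Finset.card_insert_of_notMem heD, hU, hD]
      omega
    set L := e :: r :: R.toList ++ p :: q :: M.toList with hL
    have hLlen : L.length = 2 * k + 1 := by
      simp only [hL, List.length_append, List.length_cons, Finset.length_toList, hRc, hMc]
      omega
    have hLnd : L.Nodup := by
      simp only [hL, List.cons_append, List.nodup_cons, List.nodup_append, Finset.nodup_toList,
        List.mem_append, List.mem_cons, Finset.mem_toList]
      clear * - hR hM hp hq hr hpq hqr hpr heD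
      grind
    have hw : Set.InjOn (fun j => L.getD j e) (Finset.range (2 * k + 1)) :=
      hLlen ▸ injOn_getD hLnd e
    have hUi : (Finset.range (2 * k + 1)).image (fun j => L.getD j e) = U := by
      have := image_getD_append [] L [] e
      simp only [List.length_nil, zero_add, List.nil_append, List.append_nil, hLlen,
        ← Finset.range_eq_Ico] at this
      rw [this]
      ext x
      simp only [hL, List.mem_toFinset, List.mem_append, List.mem_cons, Finset.mem_toList]
      clear * - hR hM hp hq hr heD heU hDU
      grind
    have hDi : (Finset.Ico 1 (k + 3)).image (fun j => L.getD j e) = D := by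
      have := image_getD_append [e] (r :: R.toList ++ [p, q]) M.toList e
      have hlen : [e].length + (r :: R.toList ++ [p, q]).length = k + 3 := by
        simp only [List.length_append, List.length_cons, List.length_nil, Finset.length_toList,
          hRc]
        omega
      have hL' : [e] ++ (r :: R.toList ++ [p, q]) ++ M.toList = L := by simp [hL]
      rw [hlen, hL'] at this
      refine this.trans ?_
      ext x
      simp only [List.mem_toFinset, List.mem_append, List.mem_cons, Finset.mem_toList]
      clear * - hR hp hq hr
      grind
    have key := twoStep_erase_trans_of_enum hk2 hf hc hw hUi hDi
    have g₁ : L.getD 1 e = r := by simp [hL]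
    have hlen : (e :: r :: R.toList).length = k + 1 := by
      simp only [List.length_cons, Finset.length_toList, hRc]
      omega
    have g₂ : L.getD (k + 1) e = p := by
      rw [hL, List.getD_append_right _ _ _ _ hlen.le, hlen, Nat.sub_self, List.getD_cons_zero]
    have g₃ : L.getD (k + 2) e = q := by
      rw [hL, List.getD_append_right _ _ _ _ (by omega), hlen,
        show k + 2 - (k + 1) = 0 + 1 by omega, List.getD_cons_succ, List.getD_cons_zero]
    simpa only [g₁, g₂, g₃] using key

theorem exists_potential_of_cyclic {k : ℕ} (hk : 1 ≤ k) (hf : ∀ X Y, f X Y = -f Y X)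
    (hc : ∀ i : ZMod (2 * k + 1) → α, Function.Injective i →
      ∑ m : ZMod (2 * k + 1), f (arc k i m) (arc k i (m + (k : ZMod (2 * k + 1)))) = 0)
    (U : Finset α) : ∃ φ : Finset α → ℚ, ∀ S T, S.card = k + 1 → T.card = k + 1 →
      (S ∩ T).card = 1 → S ∪ T = U → f S T = φ T - φ S := by
  by_cases hU : U.card = 2 * k + 1
  swap
  · refine ⟨0, fun S T hS hT hST hSTU => absurd ?_ hU⟩
    have := Finset.card_union_add_card_inter S T
    rw [hSTU] at this
    omega
  obtain ⟨φ, hφ⟩ := exists_potential U k (twoStep f U) (twoStep_antisymm hf U)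
    (fun E _ _ a _ b _ c _ _ hb hc' => twoStep_insert_trans hf U hb hc')
    (fun D hDU hD a ha b hb c hc' => twoStep_erase_trans hk hf hc hU hDU hD ha hb hc')
  refine ⟨φ, fun S T hS hT hST hSTU => ?_⟩
  obtain ⟨t, ht⟩ := Finset.card_eq_one.mp hST
  have htST : t ∈ S ∩ T := ht ▸ Finset.mem_singleton_self t
  rw [Finset.mem_inter] at htST
  obtain ⟨htS, htT⟩ := htST
  have hSc : (S.erase t).card = k := by rw [Finset.card_erase_of_mem htS, hS]; rfl
  have hTc : (T.erase t).card = k := by rw [Finset.card_erase_of_mem htT, hT]; rfl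
  set L := (T.erase t).toList ++ t :: (S.erase t).toList with hL
  have hLlen : L.length = 2 * k + 1 := by
    simp only [hL, List.length_append, List.length_cons, Finset.length_toList, hSc, hTc]
    omega
  have hLnd : L.Nodup := by
    simp only [hL, List.nodup_cons, List.nodup_append, Finset.nodup_toList,
      List.mem_cons, Finset.mem_toList]
    have hmem : ∀ x, x ∈ S → x ∈ T → x = t := fun x hS hT =>
      Finset.mem_singleton.mp (ht ▸ Finset.mem_inter.mpr ⟨hS, hT⟩)
    clear * - hmem
    grind
  have hw : Set.InjOn (fun j => L.getD j t) (Finset.range (2 * k + 1)) :=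
    hLlen ▸ injOn_getD hLnd t
  have hUi : (Finset.range (2 * k + 1)).image (fun j => L.getD j t) = U := by
    have := image_getD_append [] L [] t
    simp only [List.length_nil, zero_add, List.nil_append, List.append_nil, hLlen,
      ← Finset.range_eq_Ico] at this
    rw [this]
    ext x
    simp only [hL, List.mem_toFinset, List.mem_append, List.mem_cons, Finset.mem_toList]
    clear * - hSTU htS htT
    grind
  have hT0 : window k (fun j => L.getD j t) 0 = T := by
    have := image_getD_append [] ((T.erase t).toList ++ [t]) (S.erase t).toList t
    have hL' : [] ++ ((T.erase t).toList ++ [t]) ++ (S.erase t).toList = L := by simp [hL]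
    rw [hL'] at this
    simp only [List.length_append, List.length_cons, List.length_nil, Finset.length_toList,
      hTc, zero_add] at this
    rw [window, zero_add, this]
    ext x
    simp only [List.mem_toFinset, List.mem_append, List.mem_cons, Finset.mem_toList]
    clear * - htT
    grind
  have hSk : window k (fun j => L.getD j t) k = S := by
    have := image_getD_append (T.erase t).toList (t :: (S.erase t).toList) [] t
    rw [List.append_nil] at this
    simp only [List.length_cons, Finset.length_toList, hTc, hSc] at this
    rw [window, add_assoc, this]
    ext x
    simp only [List.mem_toFinset, List.mem_cons, Finset.mem_toList]
    clear * - htS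
    grind
  have s := sum_twoStep_window hc hw
  rw [hUi, Finset.sum_congr rfl (g := fun j => φ (window k (fun j => L.getD j t) (j + 1)) -
    φ (window k (fun j => L.getD j t) j)), Finset.sum_range_sub
      (fun j => φ (window k (fun j => L.getD j t) j)), hT0, hSk] at s
  · linarith
  · intro j hj
    rw [Finset.mem_range] at hj
    have hsub : Finset.Ico (j + 1) (j + k + 1) ⊆ Finset.range (2 * k + 1) := fun a => by
      simp only [Finset.mem_Ico, Finset.mem_range]; omega
    have hmem : ∀ a, a < 2 * k + 1 → L.getD a t ∈ U := fun a ha => by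
      rw [← hUi]; exact Finset.mem_image_of_mem _ (Finset.mem_range.mpr ha)
    rw [window_eq_insert, window_succ_eq_insert]
    refine hφ _ ?_ ?_ _ (hmem _ (by omega)) _ (hmem _ (by omega)) ?_ ?_
    · rw [← hUi]; exact Finset.image_subset_image hsub
    · rw [Finset.card_image_of_injOn (hw.mono hsub), Nat.card_Ico]; omega
    · exact notMem_image_of_injOn hw hsub (Finset.mem_range.mpr (by omega)) (by simp)
    · exact notMem_image_of_injOn hw hsub (Finset.mem_range.mpr (by omega)) (by simp)

end

theorem card_arc {α : Type*} [DecidableEq α] {k : ℕ} {i : ZMod (2 * k + 1) → α}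
    (hi : Function.Injective i) (m : ZMod (2 * k + 1)) : (arc k i m).card = k + 1 := by
  rw [arc, Finset.card_image_of_injOn, Finset.card_range]
  intro a ha b hb hab
  rw [Finset.mem_coe, Finset.mem_range] at ha hb
  have := congrArg ZMod.val (add_left_cancel (hi hab))
  rwa [ZMod.val_natCast, ZMod.val_natCast, Nat.mod_eq_of_lt (by omega),
    Nat.mod_eq_of_lt (by omega)] at this

theorem arc_add_sdiff_arc {α : Type*} [DecidableEq α] (k : ℕ) (i : ZMod (2 * k + 1) → α)
    (m : ZMod (2 * k + 1)) :
    arc k i (m + k) \ arc k i m = arc k i (m + (k + 1)) \ arc k i m := by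
  have h0 : ((2 * k + 1 : ℕ) : ZMod (2 * k + 1)) = 0 := ZMod.natCast_self _
  push_cast at h0
  ext x
  simp only [Finset.mem_sdiff, and_congr_left_iff]
  intro hx
  simp only [arc, Finset.mem_image, Finset.mem_range, not_exists, not_and] at hx ⊢
  constructor
  · rintro ⟨l, hl, rfl⟩
    rcases l with _ | l
    · exact absurd (by simp) (hx k (by omega))
    · exact ⟨l, by omega, by push_cast; ring_nf⟩
  · rintro ⟨l, hl, rfl⟩
    rcases Nat.lt_succ_iff_lt_or_eq.mp hl with h | rfl
    · exact ⟨l + 1, by omega, by push_cast; ring_nf⟩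
    · refine absurd ?_ (hx 0 (by omega))
      congr 1
      push_cast
      linear_combination -h0

theorem arc_inter_arc_add_nonempty {α : Type*} [DecidableEq α] (k : ℕ)
    (i : ZMod (2 * k + 1) → α) (m : ZMod (2 * k + 1)) :
    (arc k i m ∩ arc k i (m + k)).Nonempty := by
  refine ⟨i (m + k), Finset.mem_inter.mpr ⟨?_, ?_⟩⟩
  · exact Finset.mem_image.mpr ⟨k, by simp, rfl⟩
  · exact Finset.mem_image.mpr ⟨0, by simp, by simp⟩

section

variable {k n : ℕ}

theorem eTensor_apply (S T P Q : OSGen k n) :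
    eTensor k n S T (P, Q) = if P = S ∧ Q = T then 1 else 0 := by
  simp [eTensor]

theorem eTensor_swap (S T P Q : OSGen k n) :
    eTensor k n S T (P, Q) = eTensor k n T S (Q, P) := by
  simp only [eTensor_apply, and_comm]

theorem bform_eq_dotProduct (x y : TensorSq k n) : bform k n x y = x ⬝ᵥ y := rfl

theorem bform_eTensor (x : TensorSq k n) (S T : OSGen k n) :
    bform k n x (eTensor k n S T) = x (S, T) := by
  simp [bform, eTensor]

theorem orthogonal_RA_iff (x : TensorSq k n) :
    (∀ y ∈ RA k n, bform k n x y = 0) ↔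
      (∀ S T, x (S, T) = -x (T, S)) ∧
      (∀ S T : OSGen k n, 2 ≤ (S.1 ∩ T.1).card → x (S, T) = 0) ∧
      (∀ i : ZMod (2 * k + 1) → Fin n, Function.Injective i →
        ∀ A : ZMod (2 * k + 1) → OSGen k n, (∀ m, (A m).1 = arc k i m) →
          ∑ m, x (A m, A (m + k)) = 0) := by
  constructor
  · intro h
    have h' : ∀ y ∈ RAset k n, bform k n x y = 0 := fun y hy => h y (Submodule.subset_span hy)
    refine ⟨fun S T => ?_, fun S T hST => ?_, fun i hi A hA => ?_⟩
    · have := h' _ (Or.inl ⟨S, T, rfl⟩)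
      rw [bform_eq_dotProduct, dotProduct_add, ← bform_eq_dotProduct, ← bform_eq_dotProduct,
        bform_eTensor, bform_eTensor] at this
      linarith
    · rw [← bform_eTensor x S T]
      exact h' _ (Or.inr (Or.inl ⟨S, T, hST, rfl⟩))
    · have := h' _ (Or.inr (Or.inr ⟨i, hi, A, hA, rfl⟩))
      rw [bform_eq_dotProduct, dotProduct_sum] at this
      simpa only [← bform_eq_dotProduct, bform_eTensor] using this
  · rintro ⟨h₁, h₂, h₃⟩ y hy
    induction hy using Submodule.span_induction with
    | zero => rw [bform_eq_dotProduct, dotProduct_zero]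
    | add y z _ _ hy hz => rw [bform_eq_dotProduct] at *; rw [dotProduct_add, hy, hz, add_zero]
    | smul c y _ hy => rw [bform_eq_dotProduct] at *; rw [dotProduct_smul, hy, smul_zero]
    | mem y hy =>
      rcases hy with ⟨S, T, rfl⟩ | ⟨S, T, hST, rfl⟩ | ⟨i, hi, A, hA, rfl⟩
      · rw [bform_eq_dotProduct, dotProduct_add, ← bform_eq_dotProduct, ← bform_eq_dotProduct,
          bform_eTensor, bform_eTensor, h₁ S T]
        ring
      · rw [bform_eTensor, h₂ S T hST]
      · rw [bform_eq_dotProduct, dotProduct_sum]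
        simp only [← bform_eq_dotProduct, bform_eTensor]
        exact h₃ i hi A hA

/-- For `I ∩ J = {t}`, the sets `insert s (J.erase t)` with `s ∈ I` are exactly the
`(k+1)`-element sets `Q` with `Q \ I = J.erase t`. -/
theorem exists_eq_insert_iff {I J Q : OSGen k n} {t : Fin n} (ht : I.1 ∩ J.1 = {t}) :
    (∃ s ∈ I.1, Q.1 = insert s (J.1.erase t)) ↔ Q.1 \ I.1 = J.1.erase t := by
  have hmem : ∀ x, x ∈ I.1 ∧ x ∈ J.1 ↔ x = t := fun x => by
    rw [← Finset.mem_inter, ht, Finset.mem_singleton]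
  have htJ : t ∈ J.1 := ((hmem t).mpr rfl).2
  constructor
  · rintro ⟨s, hs, h⟩
    rw [h]
    clear * - hs hmem
    grind
  · intro h
    have h₁ : (Q.1 \ I.1).card = k := by
      rw [h, Finset.card_erase_of_mem htJ, J.2]; rfl
    have h₂ := Finset.card_sdiff_add_card_inter Q.1 I.1
    obtain ⟨s, hs⟩ := Finset.card_eq_one.mp (by rw [h₁, Q.2] at h₂; omega : (Q.1 ∩ I.1).card = 1)
    have hsI : s ∈ Q.1 ∩ I.1 := hs ▸ Finset.mem_singleton_self s
    refine ⟨s, (Finset.mem_inter.mp hsI).2, ?_⟩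
    rw [← h, Finset.insert_eq, ← hs, Finset.union_comm, Finset.sdiff_union_inter]

theorem insert_erase_injOn {I J : Finset (Fin n)} {t : Fin n} (ht : I ∩ J = {t}) :
    Set.InjOn (fun s => insert s (J.erase t)) I := by
  have hmem : ∀ x ∈ I, x ∉ J.erase t := fun x hx hxJ => by
    rw [Finset.mem_erase] at hxJ
    have := Finset.mem_inter.mpr ⟨hx, hxJ.2⟩
    rw [ht, Finset.mem_singleton] at this
    exact hxJ.1 this
  intro s hs s' _ h
  have : s ∈ insert s' (J.erase t) := h.subset (Finset.mem_insert_self s _)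
  exact (Finset.mem_insert.mp this).resolve_right (hmem s hs)

theorem sum_eTensor_insert {I J : OSGen k n} {t : Fin n} (ht : I.1 ∩ J.1 = {t})
    {K : {s // s ∈ I.1} → OSGen k n} (hK : ∀ s, (K s).1 = insert s.1 (J.1.erase t))
    (P Q : OSGen k n) :
    ∑ s, eTensor k n I (K s) (P, Q) = if P = I ∧ Q.1 \ P.1 = J.1.erase t then 1 else 0 := by
  simp only [eTensor_apply]
  by_cases hP : P = I
  swap
  · simp [hP]
  subst hP
  simp only [true_and]
  split_ifs with h
  · obtain ⟨s, hs, hQ⟩ := (exists_eq_insert_iff ht).mpr h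
    have hQK : ∀ s', Q = K s' ↔ s' = ⟨s, hs⟩ := by
      intro s'
      rw [Subtype.ext_iff, Subtype.ext_iff, hK, hQ]
      constructor
      · exact fun h' => (insert_erase_injOn ht hs s'.2 h').symm
      · intro h'; rw [h']
    simp only [hQK, Finset.sum_ite_eq', Finset.mem_univ, if_true]
  · refine Finset.sum_eq_zero fun s _ => if_neg fun hQ => h ?_
    exact (exists_eq_insert_iff ht).mp ⟨s, s.2, by rw [hQ, hK]⟩

theorem orthogonal_of_mem_RLset {x : TensorSq k n} (hx : x ∈ RLset k n) :
    ∀ y ∈ RA k n, bform k n x y = 0 := by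
  rw [orthogonal_RA_iff]
  rcases hx with ⟨S, T, hST, rfl⟩ | ⟨I, J, t, ht, K, hK, rfl⟩
  · have hzero : ∀ P Q : OSGen k n, (P.1 ∩ Q.1).Nonempty →
        (eTensor k n S T - eTensor k n T S) (P, Q) = 0 := by
      intro P Q hPQ
      rw [Finset.disjoint_iff_inter_eq_empty] at hST
      rw [Pi.sub_apply, eTensor_apply, eTensor_apply, if_neg, if_neg, sub_zero]
      · rintro ⟨rfl, rfl⟩
        rw [Finset.inter_comm, hST] at hPQ
        simp at hPQ
      · rintro ⟨rfl, rfl⟩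
        rw [hST] at hPQ
        simp at hPQ
    refine ⟨fun P Q => ?_, fun P Q h => ?_, fun i _ A hA => ?_⟩
    · rw [Pi.sub_apply, Pi.sub_apply, eTensor_swap S T P Q, eTensor_swap T S P Q]; ring
    · exact hzero P Q (Finset.card_pos.mp (by omega))
    · refine Finset.sum_eq_zero fun m _ => hzero _ _ ?_
      rw [hA, hA]
      exact arc_inter_arc_add_nonempty k i m
  · have hval : ∀ P Q : OSGen k n,
        (∑ s, (eTensor k n I (K s) - eTensor k n (K s) I)) (P, Q) =
          (if P = I ∧ Q.1 \ P.1 = J.1.erase t then 1 else 0) -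
          (if Q = I ∧ P.1 \ Q.1 = J.1.erase t then 1 else 0) := by
      intro P Q
      rw [Finset.sum_apply, ← sum_eTensor_insert ht hK, ← sum_eTensor_insert ht hK,
        ← Finset.sum_sub_distrib]
      refine Finset.sum_congr rfl fun s _ => ?_
      rw [Pi.sub_apply, eTensor_swap (K s) I]
    have hcard : ∀ P Q : OSGen k n, 2 ≤ (P.1 ∩ Q.1).card → Q.1 \ P.1 ≠ J.1.erase t := by
      intro P Q h₂ h
      have htJ : t ∈ J.1 := (Finset.mem_inter.mp (ht ▸ Finset.mem_singleton_self t)).2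
      have h₁ : (Q.1 \ P.1).card = k := by
        rw [h, Finset.card_erase_of_mem htJ, J.2]; rfl
      have h₃ := Finset.card_sdiff_add_card_inter Q.1 P.1
      rw [h₁, Q.2, Finset.inter_comm] at h₃
      omega
    refine ⟨fun P Q => ?_, fun P Q h => ?_, fun i _ A hA => ?_⟩
    · rw [hval, hval]; ring
    · rw [hval, if_neg fun h' => hcard P Q h h'.2,
        if_neg fun h' => hcard Q P (by rwa [Finset.inter_comm]) h'.2, sub_zero]
    · simp only [hval, Finset.sum_sub_distrib]
      rw [sub_eq_zero, ← Equiv.sum_comp (Equiv.addRight ((k : ZMod (2 * k + 1)) + 1))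
        (fun m => if A (m + k) = I ∧ (A m).1 \ (A (m + k)).1 = J.1.erase t then (1 : ℚ) else 0)]
      refine Finset.sum_congr rfl fun m _ => ?_
      have h0 : ((2 * k + 1 : ℕ) : ZMod (2 * k + 1)) = 0 := ZMod.natCast_self _
      push_cast at h0
      have hm : m + ((k : ZMod (2 * k + 1)) + 1) + k = m := by linear_combination h0
      rw [Equiv.coe_addRight, hm, hA, hA, hA, arc_add_sdiff_arc]

theorem sum_filter_sdiff_mem_RL (S : OSGen k n) (B : Finset (Fin n)) :
    ∑ T : OSGen k n with (S.1 ∩ T.1).card = 1 ∧ T.1 \ S.1 = B,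
      (eTensor k n S T - eTensor k n T S) ∈ RL k n := by
  rcases Finset.eq_empty_or_nonempty
    ({T : OSGen k n | (S.1 ∩ T.1).card = 1 ∧ T.1 \ S.1 = B} : Finset _) with h | ⟨J, hJ⟩
  · rw [h, Finset.sum_empty]; exact Submodule.zero_mem _
  rw [Finset.mem_filter] at hJ
  obtain ⟨-, hJ₁, rfl⟩ := hJ
  obtain ⟨t, ht⟩ := Finset.card_eq_one.mp hJ₁
  have hmem : ∀ x, x ∈ S.1 ∧ x ∈ J.1 ↔ x = t := fun x => by
    rw [← Finset.mem_inter, ht, Finset.mem_singleton]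
  have htJ : t ∈ J.1 := ((hmem t).mpr rfl).2
  have hcard : ∀ s : {s // s ∈ S.1}, (insert s.1 (J.1.erase t)).card = k + 1 := by
    intro s
    have hs := s.2
    rw [Finset.card_insert_of_notMem (by clear * - hs hmem; grind),
      Finset.card_erase_of_mem htJ, J.2]
    rfl
  have hJt : J.1 \ S.1 = J.1.erase t := by clear * - hmem; grind
  refine Submodule.subset_span (Or.inr ⟨S, J, t, ht, fun s => ⟨_, hcard s⟩, fun s => rfl, ?_⟩)
  symm
  refine Finset.sum_bij (fun s _ => ⟨_, hcard s⟩) ?_ ?_ ?_ (fun _ _ => rfl)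
  · intro s _
    have hs := s.2
    rw [Finset.mem_filter]
    refine ⟨Finset.mem_univ _, ?_, ?_⟩
    · rw [Finset.card_eq_one]
      exact ⟨s.1, by clear * - hs hmem; grind⟩
    · rw [hJt]
      exact (exists_eq_insert_iff ht).mp ⟨s, hs, rfl⟩
  · intro s _ s' _ h
    rw [Subtype.mk.injEq] at h
    exact Subtype.ext (insert_erase_injOn ht s.2 s'.2 h)
  · intro T hT
    rw [Finset.mem_filter, hJt] at hT
    obtain ⟨s, hs, h⟩ := (exists_eq_insert_iff ht).mpr hT.2.2
    exact ⟨⟨s, hs⟩, Finset.mem_univ _, Subtype.ext h.symm⟩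

/-- Extension by zero of a coefficient function to pairs of arbitrary finite sets. -/
def coeff (x : TensorSq k n) (X Y : Finset (Fin n)) : ℚ :=
  if h : X.card = k + 1 ∧ Y.card = k + 1 then x (⟨X, h.1⟩, ⟨Y, h.2⟩) else 0

theorem coeff_coe (x : TensorSq k n) (S T : OSGen k n) : coeff x S.1 T.1 = x (S, T) :=
  dif_pos ⟨S.2, T.2⟩

theorem two_smul_eq_sum {x : TensorSq k n} (hx : ∀ S T, x (S, T) = -x (T, S)) :
    (2 : ℚ) • x = ∑ S, ∑ T, x (S, T) • (eTensor k n S T - eTensor k n T S) := by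
  ext ⟨P, Q⟩
  simp only [Finset.sum_apply, Pi.smul_apply, Pi.sub_apply, smul_eq_mul, eTensor_apply, mul_sub,
    Finset.sum_sub_distrib, ite_and, mul_ite, mul_one, mul_zero]
  simp only [Finset.sum_ite_eq, Finset.sum_ite_irrel, Finset.sum_const_zero, Finset.mem_univ,
    if_true]
  linarith [hx P Q]

theorem mem_RL_of_orthogonal (hk : 1 ≤ k) {x : TensorSq k n}
    (hx : ∀ y ∈ RA k n, bform k n x y = 0) : x ∈ RL k n := by
  obtain ⟨h₁, h₂, h₃⟩ := (orthogonal_RA_iff x).mp hx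
  have hanti : ∀ X Y, coeff x X Y = -coeff x Y X := by
    intro X Y
    unfold coeff
    by_cases h : X.card = k + 1 ∧ Y.card = k + 1
    · rw [dif_pos h, dif_pos h.symm, h₁]
    · rw [dif_neg h, dif_neg fun h' => h h'.symm, neg_zero]
  have hcyc : ∀ i : ZMod (2 * k + 1) → Fin n, Function.Injective i →
      ∑ m : ZMod (2 * k + 1), coeff x (arc k i m) (arc k i (m + (k : ZMod (2 * k + 1)))) = 0 := by
    intro i hi
    rw [← h₃ i hi (fun m => ⟨arc k i m, card_arc hi m⟩) fun m => rfl]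
    exact Finset.sum_congr rfl fun m _ => coeff_coe x ⟨_, card_arc hi m⟩ ⟨_, card_arc hi _⟩
  choose φ hφ using exists_potential_of_cyclic hk hanti hcyc
  set d : OSGen k n → OSGen k n → TensorSq k n :=
    fun S T => eTensor k n S T - eTensor k n T S with hd
  have hsplit : ∀ S T, x (S, T) • d S T =
      (if (S.1 ∩ T.1).card = 0 then x (S, T) • d S T else 0) +
      ((if (S.1 ∩ T.1).card = 1 then φ (T.1 ∪ S.1) T.1 • d S T else 0) -
       (if (S.1 ∩ T.1).card = 1 then φ (S.1 ∪ T.1) S.1 • d S T else 0)) := by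
    intro S T
    obtain h | h | h : (S.1 ∩ T.1).card = 0 ∨ (S.1 ∩ T.1).card = 1 ∨ 2 ≤ (S.1 ∩ T.1).card := by
      omega
    · simp [h]
    · have := hφ (S.1 ∪ T.1) S.1 T.1 S.2 T.2 h rfl
      rw [coeff_coe] at this
      rw [if_neg (by omega), if_pos h, if_pos h, this, zero_add, ← sub_smul,
        Finset.union_comm T.1]
    · rw [if_neg (by omega), if_neg (by omega), if_neg (by omega), h₂ S T h, zero_smul]
      simp
  have hflip : ∑ S, ∑ T, (if (S.1 ∩ T.1).card = 1 then φ (T.1 ∪ S.1) T.1 • d S T else 0) =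
      -∑ S, ∑ T, (if (S.1 ∩ T.1).card = 1 then φ (S.1 ∪ T.1) S.1 • d S T else 0) := by
    rw [Finset.sum_comm, ← Finset.sum_neg_distrib]
    refine Finset.sum_congr rfl fun S _ => ?_
    rw [← Finset.sum_neg_distrib]
    refine Finset.sum_congr rfl fun T _ => ?_
    have hdd : d T S = -d S T := by simp [hd]
    rw [hdd, Finset.inter_comm]
    split_ifs <;> simp
  have hone : ∑ S, ∑ T, (if (S.1 ∩ T.1).card = 1 then φ (S.1 ∪ T.1) S.1 • d S T else 0) ∈
      RL k n := by
    refine Submodule.sum_mem _ fun S _ => ?_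
    rw [← Finset.sum_filter, ← Finset.sum_fiberwise _ fun T : OSGen k n => T.1 \ S.1]
    refine Submodule.sum_mem _ fun B _ => ?_
    have : ∀ T ∈ ({T : OSGen k n | (S.1 ∩ T.1).card = 1 ∧ T.1 \ S.1 = B} : Finset _),
        φ (S.1 ∪ T.1) S.1 • d S T = φ (S.1 ∪ B) S.1 • d S T := by
      intro T hT
      rw [Finset.mem_filter] at hT
      rw [← hT.2.2, Finset.union_sdiff_self_eq_union]
    rw [Finset.filter_filter, Finset.sum_congr rfl this, ← Finset.smul_sum]
    exact Submodule.smul_mem _ _ (sum_filter_sdiff_mem_RL S B)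
  have hzero : ∑ S, ∑ T, (if (S.1 ∩ T.1).card = 0 then x (S, T) • d S T else 0) ∈ RL k n := by
    refine Submodule.sum_mem _ fun S _ => Submodule.sum_mem _ fun T _ => ?_
    split_ifs with h
    · refine Submodule.smul_mem _ _ (Submodule.subset_span (Or.inl ⟨S, T, ?_, rfl⟩))
      rwa [Finset.card_eq_zero, ← Finset.disjoint_iff_inter_eq_empty] at h
    · exact Submodule.zero_mem _
  have h2x : (2 : ℚ) • x ∈ RL k n := by
    rw [two_smul_eq_sum h₁]
    change ∑ S, ∑ T, x (S, T) • d S T ∈ RL k n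
    rw [Finset.sum_congr rfl fun S _ => Finset.sum_congr rfl fun T _ => hsplit S T]
    simp only [Finset.sum_add_distrib, Finset.sum_sub_distrib]
    rw [hflip]
    exact Submodule.add_mem _ hzero (Submodule.sub_mem _ (Submodule.neg_mem _ hone) hone)
  exact (Submodule.smul_mem_iff _ two_ne_zero).mp h2x

end

/-- `R_L` equals the orthogonal complement of `R_A` in `V ⊗ V` with
respect to the given bilinear form: `R_L = R_A^⊥`.  This is the quadratic duality between
the generalized Orlik–Solomon algebra `𝒜^k(n)` and the generalized Drinfeld–Kohno Lie
algebra `𝔱^k(n)`. -/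
theorem RL_eq_RA_orthogonal (k n : ℕ) (hk : 1 ≤ k) (hn : 1 ≤ n) :
    ∀ x : TensorSq k n, x ∈ RL k n ↔ ∀ y ∈ RA k n, bform k n x y = 0 := by
  intro x
  refine ⟨fun hx => ?_, mem_RL_of_orthogonal hk⟩
  induction hx using Submodule.span_induction with
  | mem x hx => exact orthogonal_of_mem_RLset hx
  | zero => exact fun y _ => zero_dotProduct y
  | add x z _ _ hx hz =>
    intro y hy
    rw [bform_eq_dotProduct, add_dotProduct, ← bform_eq_dotProduct, ← bform_eq_dotProduct,
      hx y hy, hz y hy, add_zero]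
  | smul c x _ hx =>
    intro y hy
    rw [bform_eq_dotProduct, smul_dotProduct, ← bform_eq_dotProduct, hx y hy, smul_zero]
end
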